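/- Let r ≥ 2 and let N be a normal subgroup of F_r such that Γ_1(N) = F_r/N is an infinite nilpotent group, and let D ≥ 1 be such that Γ_1(N) has polynomial volume growth of degree D. Let μ be the lazy simple random walk measure on Γ_2(N) = F_r/[N,N]. Then there exists a constant C ≥ 1 such that for all n ≥ 2: exp(−C·n^{D/(2+D)}·(log n)^{2/(2+D)}) ≤ μ^{(2n)}(e) ≤ exp(−(1/C)·n^{D/(2+D)}·(log n)^{2/(2+D)}). -/

import Mathlib

open scoped Pointwise

noncomputable section

open Classical in
/-- Convolution of two real-valued functions ("measures") on a group: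
`(μ ∗ ν)(g) = Σ_h μ(h) ν(h⁻¹ g)`. -/
noncomputable def conv {G : Type*} [Group G] (μ ν : G → ℝ) : G → ℝ :=
  fun g => ∑' h : G, μ h * ν (h⁻¹ * g)

open Classical in
/-- `convPow μ n` is the `n`-fold convolution power of `μ`;
`convPow μ 0` is the Dirac mass at the identity. -/
noncomputable def convPow {G : Type*} [Group G] (μ : G → ℝ) : ℕ → G → ℝ
  | 0 => fun g => if g = 1 then 1 else 0
  | n + 1 => conv μ (convPow μ n)

/-- Pushforward of a measure along a map. -/
noncomputable def pushforward {G H : Type*} (f : G → H) (μ : G → ℝ) : H → ℝ :=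
  fun h => ∑' g : {g : G // f g = h}, μ g.1

open Classical in
/-- The lazy simple random walk measure on the free group on `r` generators:
mass `1/2` at the identity and mass `1/(4r)` at each `sᵢ^{±1}`. -/
noncomputable def lazySRW (r : ℕ) : FreeGroup (Fin r) → ℝ := fun g =>
  if g = 1 then 1 / 2
  else if ∃ i : Fin r, g = FreeGroup.of i ∨ g = (FreeGroup.of i)⁻¹ then 1 / (4 * r)
  else 0

/-- The lazy simple random walk measure on the quotient `F_r / M`, i.e. the pushforward
of `lazySRW r` under the quotient map. -/
noncomputable def lazySRWQuot (r : ℕ) (M : Subgroup (FreeGroup (Fin r))) [M.Normal] :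
    FreeGroup (Fin r) ⧸ M → ℝ :=
  pushforward (QuotientGroup.mk : FreeGroup (Fin r) → FreeGroup (Fin r) ⧸ M) (lazySRW r)

/-- Iterated logarithms: `iterLog 1 x = log (1 + x)` and
`iterLog (i+1) x = log (1 + iterLog i x)`. -/
noncomputable def iterLog : ℕ → ℝ → ℝ
  | 0, x => x
  | n + 1, x => Real.log (1 + iterLog n x)

instance derivedSeriesNormal (G : Type*) [Group G] (n : ℕ) : (derivedSeries G n).Normal :=
  derivedSeries_normal G n

/-- `G` has polynomial volume growth of degree `D`: there is a finite symmetric generating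
set `S` containing the identity and constants `0 < c ≤ C` with
`c·n^D ≤ #(Sⁿ) ≤ C·n^D` for all `n ≥ 1`. -/
def HasPolyGrowth (G : Type*) [Group G] (D : ℕ) : Prop :=
  ∃ S : Set G, S.Finite ∧ (1 : G) ∈ S ∧ (∀ x ∈ S, x⁻¹ ∈ S) ∧ Subgroup.closure S = ⊤ ∧
    ∃ c C : ℝ, 0 < c ∧ c ≤ C ∧ ∀ n : ℕ, 1 ≤ n →
      c * (n : ℝ) ^ D ≤ (Nat.card ↥(S ^ n) : ℝ) ∧ (Nat.card ↥(S ^ n) : ℝ) ≤ C * (n : ℝ) ^ D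

/-- `G` has exponential volume growth: there is a finite symmetric generating set `S`
containing the identity and `c > 0` with `#(Sⁿ) ≥ e^{cn}` for all `n ≥ 1`. -/
def HasExpGrowth (G : Type*) [Group G] : Prop :=
  ∃ S : Set G, S.Finite ∧ (1 : G) ∈ S ∧ (∀ x ∈ S, x⁻¹ ∈ S) ∧ Subgroup.closure S = ⊤ ∧
    ∃ c : ℝ, 0 < c ∧ ∀ n : ℕ, 1 ≤ n → Real.exp (c * n) ≤ (Nat.card ↥(S ^ n) : ℝ)

open Function

set_option linter.unusedSectionVars false

section generic
variable {X : Type*} {r : ℕ}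

/-- The lazy Markov operator attached to `r` permutations. -/
noncomputable def Pop (σ : Fin r → Equiv.Perm X) (f : X → ℝ) : X → ℝ := fun x =>
  f x / 2 + (1 / (4 * r)) * ∑ j, (f (σ j x) + f ((σ j).symm x))

lemma fs_perm {f : X → ℝ} (hf : HasFiniteSupport f) (e : Equiv.Perm X) :
    HasFiniteSupport (fun x => f (e x)) := by
  have : (support fun x => f (e x)) = e ⁻¹' (support f) := rfl
  unfold HasFiniteSupport at *
  rw [this]
  exact hf.preimage (e.injective.injOn)

lemma fs_sum {ι : Type*} (s : Finset ι) {f : ι → X → ℝ} (hf : ∀ i, HasFiniteSupport (f i)) :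
    HasFiniteSupport (fun x => ∑ i ∈ s, f i x) := by
  classical
  induction s using Finset.induction_on with
  | empty => simp [HasFiniteSupport]
  | insert a s ha ih =>
    simp only [Finset.sum_insert ha]
    exact (hf a).add ih

lemma fs_mul {f : X → ℝ} (hf : HasFiniteSupport f) (g : X → ℝ) :
    HasFiniteSupport (fun x => f x * g x) := by
  refine Set.Finite.subset hf ?_
  intro x hx
  simp only [mem_support] at *
  exact fun h => hx (by simp [h])

lemma fs_cmul {f : X → ℝ} (hf : HasFiniteSupport f) (c : ℝ) :
    HasFiniteSupport (fun x => c * f x) := by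
  refine Set.Finite.subset hf ?_
  intro x hx
  simp only [mem_support] at *
  exact fun h => hx (by simp [h])

lemma fs_sq {f : X → ℝ} (hf : HasFiniteSupport f) : HasFiniteSupport (fun x => f x ^ 2) := by
  simpa [sq] using fs_mul hf f

lemma fs_of_imp {f g : X → ℝ} (hf : HasFiniteSupport f) (h : ∀ x, f x = 0 → g x = 0) :
    HasFiniteSupport g := by
  refine Set.Finite.subset hf ?_
  intro x hx
  simp only [mem_support] at *
  exact fun h' => hx (h x h')

lemma fs_summable {f : X → ℝ} (hf : HasFiniteSupport f) : Summable f :=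
  summable_of_hasFiniteSupport hf

lemma tsum_perm (e : Equiv.Perm X) (f : X → ℝ) : ∑' x, f (e x) = ∑' x, f x := e.tsum_eq f

lemma Pop_fs (σ : Fin r → Equiv.Perm X) {f : X → ℝ} (hf : HasFiniteSupport f) :
    HasFiniteSupport (Pop σ f) := by
  unfold Pop
  refine HasFiniteSupport.add ?_ ?_
  · simpa [div_eq_mul_inv] using fs_mul hf (fun _ => 2⁻¹)
  · refine fs_cmul (fs_sum _ fun j => ?_) _
    exact (fs_perm hf _).add (fs_perm hf _)

lemma Pop_nonneg (σ : Fin r → Equiv.Perm X) {f : X → ℝ} (hf : ∀ x, 0 ≤ f x) (x : X) :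
    0 ≤ Pop σ f x := by
  unfold Pop
  have : 0 ≤ ∑ j, (f (σ j x) + f ((σ j).symm x)) :=
    Finset.sum_nonneg fun j _ => add_nonneg (hf _) (hf _)
  have := hf x
  positivity

lemma Pop_mono (σ : Fin r → Equiv.Perm X) {f g : X → ℝ} (hf : ∀ x, f x ≤ g x) (x : X) :
    Pop σ f x ≤ Pop σ g x := by
  unfold Pop
  have : ∑ j, (f (σ j x) + f ((σ j).symm x)) ≤ ∑ j, (g (σ j x) + g ((σ j).symm x)) :=
    Finset.sum_le_sum fun j _ => add_le_add (hf _) (hf _)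
  have := hf x
  gcongr

lemma fs_mul_or {f g : X → ℝ} (h : HasFiniteSupport f ∨ HasFiniteSupport g) :
    HasFiniteSupport (fun x => f x * g x) := by
  rcases h with h | h
  · exact fs_mul h g
  · simpa [mul_comm] using fs_mul h f

lemma Pop_self_adj_left (σ : Fin r → Equiv.Perm X) {f g : X → ℝ} (hf : HasFiniteSupport f) :
    ∑' x, Pop σ f x * g x = ∑' x, f x * Pop σ g x := by
  have key : ∀ (f g : X → ℝ), HasFiniteSupport f ∨ HasFiniteSupport g →
      ∑' x, Pop σ f x * g x = (∑' x, f x * g x) / 2 + (1 / (4 * r)) *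
        ∑ j, (∑' x, f (σ j x) * g x + ∑' x, f ((σ j).symm x) * g x) := by
    intro f g hf
    have e : ∀ x, Pop σ f x * g x = (1/2) * (f x * g x) + (1 / (4 * r)) *
        ∑ j, (f (σ j x) * g x + f ((σ j).symm x) * g x) := by
      intro x
      unfold Pop
      simp only [← add_mul, ← Finset.sum_mul]
      ring
    have s1 : Summable fun x => f x * g x := fs_summable (fs_mul_or hf)
    have s2 : ∀ j, Summable fun x => f (σ j x) * g x := fun j =>
      fs_summable (fs_mul_or (hf.imp (fun h => fs_perm h (σ j)) id))
    have s3 : ∀ j, Summable fun x => f ((σ j).symm x) * g x := fun j =>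
      fs_summable (fs_mul_or (hf.imp (fun h => fs_perm h (σ j).symm) id))
    simp_rw [e]
    rw [Summable.tsum_add (s1.mul_left _) (Summable.mul_left _ (summable_sum fun j _ => (s2 j).add (s3 j))),
      tsum_mul_left, tsum_mul_left, Summable.tsum_finsetSum (fun j _ => (s2 j).add (s3 j))]
    simp_rw [Summable.tsum_add (s2 _) (s3 _)]
    ring
  have comm : ∑' x, f x * Pop σ g x = ∑' x, Pop σ g x * f x := by simp_rw [mul_comm]
  rw [comm, key f g (Or.inl hf), key g f (Or.inr hf)]
  congr 2
  · simp_rw [mul_comm]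
  · refine Finset.sum_congr rfl fun j _ => ?_
    rw [add_comm]
    congr 1
    · rw [← tsum_perm (σ j)]
      simp [mul_comm]
    · rw [← tsum_perm (σ j).symm]
      simp [mul_comm]

lemma Pop_self_adj (σ : Fin r → Equiv.Perm X) {f g : X → ℝ} (hf : HasFiniteSupport f)
    (_hg : HasFiniteSupport g) :
    ∑' x, Pop σ f x * g x = ∑' x, f x * Pop σ g x := Pop_self_adj_left σ hf

lemma Pop_tsum (hr : 0 < r) (σ : Fin r → Equiv.Perm X) {f : X → ℝ} (hf : HasFiniteSupport f) :
    ∑' x, Pop σ f x = ∑' x, f x := by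
  have s1 : Summable f := fs_summable hf
  have s2 : ∀ j, Summable fun x => f (σ j x) := fun j => fs_summable (fs_perm hf _)
  have s3 : ∀ j, Summable fun x => f ((σ j).symm x) := fun j => fs_summable (fs_perm hf (σ j).symm)
  unfold Pop
  rw [Summable.tsum_add (s1.div_const _) (Summable.mul_left _ (summable_sum fun j _ => (s2 j).add (s3 j))),
      tsum_mul_left, tsum_div_const, Summable.tsum_finsetSum (fun j _ => (s2 j).add (s3 j))]
  simp_rw [Summable.tsum_add (s2 _) (s3 _), tsum_perm]
  have : (r:ℝ) ≠ 0 := by positivity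
  simp
  field_simp
  ring

/-- Dirichlet energy. -/
noncomputable def Energy (σ : Fin r → Equiv.Perm X) (f : X → ℝ) : ℝ :=
  ∑ j, ∑' x, (f x - f (σ j x)) ^ 2

lemma Pop_norm_le (hr : 0 < r) (σ : Fin r → Equiv.Perm X) {f : X → ℝ} (hf : HasFiniteSupport f) :
    ∑' x, (Pop σ f x) ^ 2 ≤ ∑' x, f x ^ 2 - (1 / (4 * r)) * Energy σ f := by
  have hr' : (0:ℝ) < r := by exact_mod_cast hr
  have s0 : Summable fun x => f x ^ 2 := fs_summable (fs_sq hf)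
  have s2 : ∀ j, Summable fun x => f (σ j x) ^ 2 := fun j => fs_summable (fs_sq (fs_perm hf _))
  have s3 : ∀ j, Summable fun x => f ((σ j).symm x) ^ 2 := fun j =>
    fs_summable (fs_sq (fs_perm hf (σ j).symm))
  have d2 : ∀ j, Summable fun x => (f x - f (σ j x)) ^ 2 := fun j =>
    fs_summable (fs_sq (hf.sub (fs_perm hf _)))
  have d3 : ∀ j, Summable fun x => (f x - f ((σ j).symm x)) ^ 2 := fun j =>
    fs_summable (fs_sq (hf.sub (fs_perm hf (σ j).symm)))
  have pw : ∀ x, (Pop σ f x) ^ 2 ≤ (1 / (8 * r)) * ∑ j,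
      (4 * f x ^ 2 + 2 * f (σ j x) ^ 2 + 2 * f ((σ j).symm x) ^ 2 - (f x - f (σ j x)) ^ 2
        - (f x - f ((σ j).symm x)) ^ 2) := by
    intro x
    have e : Pop σ f x = (1 / (4 * r)) * ∑ j, ((f x + f (σ j x)) + (f x + f ((σ j).symm x))) := by
      unfold Pop
      have : ∑ j, ((f x + f (σ j x)) + (f x + f ((σ j).symm x))) =
        ∑ j : Fin r, (2 * f x) + ∑ j, (f (σ j x) + f ((σ j).symm x)) := by
        rw [← Finset.sum_add_distrib]
        exact Finset.sum_congr rfl fun j _ => by ring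
      rw [this]
      simp
      field_simp
      ring
    rw [e, mul_pow]
    have h1 := sq_sum_le_card_mul_sum_sq (s := (Finset.univ : Finset (Fin r)))
      (f := fun j => ((f x + f (σ j x)) + (f x + f ((σ j).symm x))))
    have h2 : ∑ j, ((f x + f (σ j x)) + (f x + f ((σ j).symm x))) ^ 2 ≤ 2 * ∑ j,
      (4 * f x ^ 2 + 2 * f (σ j x) ^ 2 + 2 * f ((σ j).symm x) ^ 2 - (f x - f (σ j x)) ^ 2
        - (f x - f ((σ j).symm x)) ^ 2) := by
      rw [Finset.mul_sum]
      refine Finset.sum_le_sum fun j _ => ?_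
      nlinarith [sq_nonneg (f (σ j x) - f ((σ j).symm x))]
    simp only [Finset.card_univ, Fintype.card_fin] at h1
    calc _ ≤ (1 / (4 * (r:ℝ)))^2 * (r * (2 * ∑ j,
      (4 * f x ^ 2 + 2 * f (σ j x) ^ 2 + 2 * f ((σ j).symm x) ^ 2 - (f x - f (σ j x)) ^ 2
        - (f x - f ((σ j).symm x)) ^ 2))) := by
            gcongr
            exact h1.trans (by gcongr)
      _ = _ := by
        field_simp
        ring
  have hs : ∀ j, Summable fun x => (4 * f x ^ 2 + 2 * f (σ j x) ^ 2 + 2 * f ((σ j).symm x) ^ 2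
      - (f x - f (σ j x)) ^ 2 - (f x - f ((σ j).symm x)) ^ 2) := fun j =>
    (((((s0.mul_left 4).add ((s2 j).mul_left 2)).add ((s3 j).mul_left 2)).sub (d2 j)).sub (d3 j))
  have hj : ∀ j, ∑' x, (4 * f x ^ 2 + 2 * f (σ j x) ^ 2 + 2 * f ((σ j).symm x) ^ 2
      - (f x - f (σ j x)) ^ 2 - (f x - f ((σ j).symm x)) ^ 2) =
      8 * ∑' x, f x ^ 2 - 2 * ∑' x, (f x - f (σ j x)) ^ 2 := by
    intro j
    rw [Summable.tsum_sub ((((s0.mul_left 4).add ((s2 j).mul_left 2)).add ((s3 j).mul_left 2)).sub (d2 j)) (d3 j),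
      Summable.tsum_sub (((s0.mul_left 4).add ((s2 j).mul_left 2)).add ((s3 j).mul_left 2)) (d2 j),
      Summable.tsum_add ((s0.mul_left 4).add ((s2 j).mul_left 2)) ((s3 j).mul_left 2),
      Summable.tsum_add (s0.mul_left 4) ((s2 j).mul_left 2), tsum_mul_left, tsum_mul_left, tsum_mul_left,
      tsum_perm (σ j) (fun x => f x ^ 2), tsum_perm (σ j).symm (fun x => f x ^ 2)]
    have : ∑' x, (f x - f ((σ j).symm x)) ^ 2 = ∑' x, (f x - f (σ j x)) ^ 2 := by
      rw [← tsum_perm (σ j)]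
      refine tsum_congr fun x => ?_
      simp only [Equiv.symm_apply_apply]
      ring
    rw [this]
    ring
  calc ∑' x, (Pop σ f x) ^ 2 ≤ ∑' x, (1 / (8 * (r:ℝ))) * ∑ j,
      (4 * f x ^ 2 + 2 * f (σ j x) ^ 2 + 2 * f ((σ j).symm x) ^ 2 - (f x - f (σ j x)) ^ 2
        - (f x - f ((σ j).symm x)) ^ 2) :=
        Summable.tsum_le_tsum pw (fs_summable (fs_sq (Pop_fs σ hf)))
          (Summable.mul_left _ (summable_sum fun j _ => hs j))
    _ = _ := by
      rw [tsum_mul_left, Summable.tsum_finsetSum (fun j _ => hs j)]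
      simp_rw [hj]
      rw [Finset.sum_sub_distrib]
      unfold Energy
      rw [← Finset.mul_sum _ _ (2:ℝ)]
      simp only [Finset.sum_const, Finset.card_univ, Fintype.card_fin, nsmul_eq_mul]
      generalize (∑ j, ∑' x, (f x - f (σ j x)) ^ 2) = E
      field_simp
      ring

lemma Pop_energy (hr : 0 < r) (σ : Fin r → Equiv.Perm X) {f : X → ℝ} (hf : HasFiniteSupport f) :
    ∑' x, f x * Pop σ f x = ∑' x, f x ^ 2 - (1 / (4 * r)) * Energy σ f := by
  have hr' : (0:ℝ) < r := by exact_mod_cast hr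
  have s0 : Summable fun x => f x ^ 2 := fs_summable (fs_sq hf)
  have s1 : ∀ j, Summable fun x => f x * f (σ j x) := fun j => fs_summable (fs_mul hf _)
  have s1' : ∀ j, Summable fun x => f x * f ((σ j).symm x) := fun j => fs_summable (fs_mul hf _)
  have s2 : ∀ j, Summable fun x => f (σ j x) ^ 2 := fun j => fs_summable (fs_sq (fs_perm hf _))
  have e1 : ∀ j, ∑' x, (f x - f (σ j x)) ^ 2 = 2 * ∑' x, f x ^ 2 - 2 * ∑' x, f x * f (σ j x) := by
    intro j
    have : ∀ x, (f x - f (σ j x)) ^ 2 = f x ^ 2 + f (σ j x) ^ 2 - 2 * (f x * f (σ j x)) := by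
      intro x; ring
    simp_rw [this]
    rw [Summable.tsum_sub (s0.add (s2 j)) ((s1 j).mul_left 2), Summable.tsum_add s0 (s2 j),
      tsum_perm (σ j) (fun x => f x ^ 2), tsum_mul_left]
    ring
  have e2 : ∀ j, ∑' x, f x * f ((σ j).symm x) = ∑' x, f x * f (σ j x) := by
    intro j
    rw [← tsum_perm (σ j)]
    simp [mul_comm]
  have e : ∀ x, f x * Pop σ f x = (1/2) * (f x ^ 2) + (1 / (4 * r)) *
        ∑ j, (f x * f (σ j x) + f x * f ((σ j).symm x)) := by
    intro x
    unfold Pop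
    simp only [← mul_add, ← Finset.mul_sum]
    ring
  simp_rw [e]
  rw [Summable.tsum_add (s0.mul_left _) (Summable.mul_left _ (summable_sum fun j _ => (s1 j).add (s1' j))),
      tsum_mul_left, tsum_mul_left, Summable.tsum_finsetSum (fun j _ => (s1 j).add (s1' j))]
  simp_rw [Summable.tsum_add (s1 _) (s1' _), e2]
  unfold Energy
  simp_rw [e1]
  rw [Finset.sum_sub_distrib, ← Finset.mul_sum _ _ (2:ℝ), ← Finset.mul_sum _ _ (2:ℝ), Finset.sum_add_distrib]
  simp only [Finset.sum_const, Finset.card_univ, Fintype.card_fin, nsmul_eq_mul]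
  field_simp
  ring

end generic

section cheeger
variable {X : Type*} {r : ℕ}

open Classical in
/-- Number of points of `U` sent outside of `U` by the permutation `e`. -/
noncomputable def dU (U : Finset X) (e : Equiv.Perm X) : ℕ := (U.filter (fun x => e x ∉ U)).card

/-- Total boundary of `U`. -/
noncomputable def bd (σ : Fin r → Equiv.Perm X) (U : Finset X) : ℕ := ∑ j, dU U (σ j)

open Classical in
lemma tsum_ite_finset (F : Finset X) (m : ℝ) :
    ∑' x, (if x ∈ F then m else 0) = m * F.card := by
  rw [tsum_eq_sum (s := F)]
  · simp [mul_comm]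
  · intro x hx; simp [hx]

open Classical in
lemma fs_ite_finset (F : Finset X) (m : ℝ) :
    HasFiniteSupport (fun x => if x ∈ F then m else 0) := by
  refine Set.Finite.subset F.finite_toSet ?_
  intro x hx
  by_contra h
  simp at h
  simp [h] at hx

lemma mem_fs {f : X → ℝ} (hf : HasFiniteSupport f) (x : X) :
    x ∈ Set.Finite.toFinset hf ↔ f x ≠ 0 := Set.Finite.mem_toFinset _

lemma fs_posdiff {g : X → ℝ} (hg : HasFiniteSupport g) (e : Equiv.Perm X) :
    HasFiniteSupport (fun x => max (g x - g (e x)) 0) := by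
  refine fs_of_imp (hg.sub (fs_perm hg e)) ?_
  intro x hx
  have hx' : g x - g (e x) = 0 := hx
  simp [hx']

lemma coarea (σ : Fin r → Equiv.Perm X) (κ : ℝ) (A : Finset X)
    (hA : ∀ U ⊆ A, κ * U.card ≤ bd σ U) (n : ℕ) : ∀ (g : X → ℝ) (U : Finset X),
    (∀ x, 0 ≤ g x) → U ⊆ A → U.card ≤ n → (∀ x, g x ≠ 0 ↔ x ∈ U) →
    κ * ∑' x, g x ≤ ∑ j, ∑' x, max (g x - g (σ j x)) 0 := by
  classical
  induction n with
  | zero =>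
    intro g U hg hUA hU hs
    have : U = ∅ := by simpa using hU
    subst this
    have : ∀ x, g x = 0 := by intro x; by_contra h; simpa using (hs x).1 h
    simp [this]
  | succ n ih =>
    intro g U hg hUA hU hs
    rcases U.eq_empty_or_nonempty with h | hne
    · exact ih g U hg hUA (by simp [h]) hs
    obtain ⟨x0, hx0, hmin⟩ := U.exists_min_image g hne
    set m := g x0 with hm
    have hmpos : 0 < m := lt_of_le_of_ne (hg x0) (Ne.symm ((hs x0).2 hx0))
    set g' : X → ℝ := fun x => g x - (if x ∈ U then m else 0) with hg'
    have hfs : HasFiniteSupport g := by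
      refine Set.Finite.subset U.finite_toSet ?_
      intro x hx
      exact (hs x).1 hx
    have g'nn : ∀ x, 0 ≤ g' x := by
      intro x
      by_cases h : x ∈ U
      · simp [g', h, hmin x h]
      · simp [g', h, hg x]
    have g'fs : HasFiniteSupport g' := hfs.sub (fs_ite_finset U m)
    have g'sub : g'fs.toFinset ⊆ U.erase x0 := by
      intro x hx
      have hx : g' x ≠ 0 := (mem_fs g'fs x).1 hx
      rw [Finset.mem_erase]
      constructor
      · rintro rfl; exact hx (by simp [g', hx0, hm])
      · by_contra h
        have : g x = 0 := by by_contra h'; exact h ((hs x).1 h')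
        exact hx (by simp [g', h, this])
    have hcard : g'fs.toFinset.card ≤ n := by
      have := Finset.card_le_card g'sub
      rw [Finset.card_erase_of_mem hx0] at this
      omega
    have IH := ih g' g'fs.toFinset g'nn ((g'sub.trans (Finset.erase_subset _ _)).trans hUA) hcard
      (fun x => (mem_fs g'fs x).symm)
    have e1 : ∑' x, g x = m * U.card + ∑' x, g' x := by
      have : ∀ x, g x = (if x ∈ U then m else 0) + g' x := by intro x; simp [g']
      rw [tsum_congr this, Summable.tsum_add (fs_summable (fs_ite_finset U m)) (fs_summable g'fs),
        tsum_ite_finset]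
    have e2 : ∀ j, ∑' x, max (g x - g (σ j x)) 0 = m * dU U (σ j) +
        ∑' x, max (g' x - g' (σ j x)) 0 := by
      intro j
      have : ∀ x, max (g x - g (σ j x)) 0 =
          (if x ∈ U.filter (fun x => σ j x ∉ U) then m else 0) + max (g' x - g' (σ j x)) 0 := by
        intro x
        have z : ∀ y, y ∉ U → g y = 0 := by
          intro y h; by_contra h'; exact h ((hs y).1 h')
        by_cases h1 : x ∈ U <;> by_cases h2 : σ j x ∈ U
        · simp [g', h1, h2]
        · have a1 := hmin x h1
          have a2 := z _ h2
          simp only [g', Finset.mem_filter, h1, h2, a2]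
          simp
          rw [max_eq_left (hg x), max_eq_left (by linarith)]
          ring
        · have a2 := z _ h1
          have a3 := hmin _ h2
          simp only [g', Finset.mem_filter, h1, h2, a2]
          simp
          rw [max_eq_right (by have := hg (σ j x); linarith), max_eq_right (by linarith)]
        · simp [g', h1, h2]
      rw [tsum_congr this, Summable.tsum_add (fs_summable (fs_ite_finset _ m))
        (fs_summable (fs_posdiff g'fs _)), tsum_ite_finset]
      rfl
    rw [e1, Finset.sum_congr rfl (fun j _ => e2 j), Finset.sum_add_distrib, ← Finset.mul_sum]
    have := hA U hUA
    unfold bd at this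
    push_cast at this
    nlinarith

lemma cheeger (σ : Fin r → Equiv.Perm X) (hr : 0 < r) (κ : ℝ) (hκ : 0 < κ) (A : Finset X)
    (hA : ∀ U ⊆ A, κ * U.card ≤ bd σ U) (h : X → ℝ)
    (hs : ∀ x, h x ≠ 0 → x ∈ A) :
    κ ^ 2 * ∑' x, h x ^ 2 ≤ 4 * r * Energy σ h := by
  classical
  have hr' : (0:ℝ) < r := by exact_mod_cast hr
  have hfs : HasFiniteSupport h := Set.Finite.subset A.finite_toSet fun x hx => hs x hx
  have hsq := fs_sq hfs
  have c := coarea σ κ A hA A.card (fun x => h x ^ 2) hsq.toFinset (fun x => sq_nonneg _)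
    (by intro x hx; apply hs; simpa using (mem_fs hsq x).1 hx)
    (Finset.card_le_card (by intro x hx; apply hs; simpa using (mem_fs hsq x).1 hx)) (fun x => (mem_fs hsq x).symm)
  set H := ∑' x, h x ^ 2 with hH
  -- bound each term
  have hj : ∀ j, ∑' x, max (h x ^ 2 - h (σ j x) ^ 2) 0 ≤
      (2 * r / κ) * ∑' x, (h x - h (σ j x)) ^ 2 + (κ / (2 * r)) * H := by
    intro j
    have pw : ∀ x, max (h x ^ 2 - h (σ j x) ^ 2) 0 ≤
      (2 * r / κ) * (h x - h (σ j x)) ^ 2 + (κ / (8 * r)) * (2 * h x ^ 2 + 2 * h (σ j x) ^ 2) := by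
      intro x
      have key : ∀ a b : ℝ, a ^ 2 - b ^ 2 ≤ (2 * r / κ) * (a - b) ^ 2 + (κ / (8 * r)) * (2 * a ^ 2 + 2 * b ^ 2) := by
        intro a b
        have h1 : (κ / (8 * r)) * (a + b) ^ 2 ≤ (κ / (8 * r)) * (2 * a ^ 2 + 2 * b ^ 2) := by
          gcongr
          nlinarith [sq_nonneg (a - b)]
        have h2 : 0 ≤ (2 * r / κ) * ((a - b) - (κ / (4 * r)) * (a + b)) ^ 2 := by positivity
        have h3 : (2 * r / κ) * ((a - b) - (κ / (4 * r)) * (a + b)) ^ 2 =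
          (2 * r / κ) * (a - b) ^ 2 + (κ / (8 * r)) * (a + b) ^ 2 - (a ^ 2 - b ^ 2) := by
          field_simp
          ring
        linarith
      apply max_le
      · exact key _ _
      · positivity
    have s1 : Summable fun x => (h x - h (σ j x)) ^ 2 := fs_summable (fs_sq (hfs.sub (fs_perm hfs _)))
    have s2 : Summable fun x => h x ^ 2 := fs_summable hsq
    have s3 : Summable fun x => h (σ j x) ^ 2 := fs_summable (fs_sq (fs_perm hfs _))
    calc _ ≤ ∑' x, ((2 * r / κ) * (h x - h (σ j x)) ^ 2 + (κ / (8 * r)) * (2 * h x ^ 2 + 2 * h (σ j x) ^ 2)) :=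
          Summable.tsum_le_tsum pw (fs_summable (fs_posdiff hsq (σ j)))
            ((s1.mul_left _).add (((s2.mul_left _).add (s3.mul_left _)).mul_left _))
      _ = _ := by
        rw [Summable.tsum_add (s1.mul_left _) (((s2.mul_left _).add (s3.mul_left _)).mul_left _),
          tsum_mul_left, tsum_mul_left, Summable.tsum_add (s2.mul_left _) (s3.mul_left _),
          tsum_mul_left, tsum_mul_left, tsum_perm (σ j) (fun x => h x ^ 2), ← hH]
        field_simp
        ring
  have tot := c.trans (Finset.sum_le_sum fun j _ => hj j)
  rw [Finset.sum_add_distrib, ← Finset.mul_sum] at tot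
  simp only [Finset.sum_const, Finset.card_univ, Fintype.card_fin, nsmul_eq_mul] at tot
  change κ * H ≤ 2 * r / κ * Energy σ h + r * (κ / (2 * r) * H) at tot
  have e : r * (κ / (2 * r) * H) = κ * H / 2 := by field_simp
  rw [e] at tot
  have t2 : κ * H / 2 ≤ 2 * r / κ * Energy σ h := by linarith
  have t3 := mul_le_mul_of_nonneg_left t2 (by positivity : 0 ≤ 2 * κ)
  have e3 : 2 * κ * (2 * r / κ * Energy σ h) = 4 * r * Energy σ h := by field_simp; ring
  rw [e3] at t3
  nlinarith

lemma nash (σ : Fin r → Equiv.Perm X) (hr : 0 < r) (κ : ℝ) (hκ : 0 < κ) (v : ℝ)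
    (hA : ∀ U : Finset X, (U.card : ℝ) < v → κ * U.card ≤ bd σ U) (f : X → ℝ)
    (hf : ∀ x, 0 ≤ f x) (hfs : HasFiniteSupport f) (h1 : ∑' x, f x = 1)
    (hu : 4 < v * ∑' x, f x ^ 2) :
    κ ^ 2 * ∑' x, f x ^ 2 ≤ 8 * r * Energy σ f := by
  classical
  set u := ∑' x, f x ^ 2 with hudef
  have hu0 : 0 < u := by
    have : 0 ≤ u := tsum_nonneg fun x => sq_nonneg _
    rcases this.lt_or_eq with h | h
    · exact h
    · rw [← h] at hu; norm_num at hu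
  set h : X → ℝ := fun x => max (f x - u / 4) 0 with hh
  have hhs : HasFiniteSupport h := by
    refine fs_of_imp hfs fun x hx => ?_
    simp only [h, hx]; rw [max_eq_right]; linarith
  set A := hhs.toFinset with hAdef
  have hAmem : ∀ x, x ∈ A → u / 4 ≤ f x := by
    intro x hx
    have : h x ≠ 0 := (mem_fs hhs x).1 hx
    by_contra h'
    exact this (by simp only [h]; rw [max_eq_right]; linarith)
  have hAcard : (u / 4) * A.card ≤ 1 := by
    rw [← h1, ← tsum_ite_finset]
    refine Summable.tsum_le_tsum ?_ (fs_summable (fs_ite_finset _ _)) (fs_summable hfs)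
    intro x
    split_ifs with hx
    · exact hAmem x hx
    · exact hf x
  have hAv : (A.card : ℝ) < v := by
    by_contra hc
    push Not at hc
    nlinarith
  have ch := cheeger σ hr κ hκ A (fun U hU => hA U (lt_of_le_of_lt (by exact_mod_cast Finset.card_le_card hU) hAv))
    h (fun x hx => (mem_fs hhs x).2 hx)
  have hE : Energy σ h ≤ Energy σ f := by
    unfold Energy
    refine Finset.sum_le_sum fun j _ => ?_
    refine Summable.tsum_le_tsum ?_ (fs_summable (fs_sq (hhs.sub (fs_perm hhs _))))
      (fs_summable (fs_sq (hfs.sub (fs_perm hfs _))))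
    intro x
    rw [sq_le_sq]
    have := abs_max_sub_max_le_abs (f x - u / 4) (f (σ j x) - u / 4) 0
    simpa [h] using this
  have hn : u / 2 ≤ ∑' x, h x ^ 2 := by
    have pw : ∀ x, f x ^ 2 - (u / 2) * f x ≤ h x ^ 2 := by
      intro x
      simp only [h]
      rcases le_total (f x - u / 4) 0 with hc | hc
      · rw [max_eq_right hc]
        nlinarith [hf x]
      · rw [max_eq_left hc]
        nlinarith
    have s1 : Summable fun x => f x ^ 2 := fs_summable (fs_sq hfs)
    have s2 : Summable f := fs_summable hfs
    have := Summable.tsum_le_tsum pw (s1.sub (s2.mul_left _)) (fs_summable (fs_sq hhs))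
    rw [Summable.tsum_sub s1 (s2.mul_left _), tsum_mul_left, h1, ← hudef] at this
    linarith
  have hr' : (0:ℝ) < r := by exact_mod_cast hr
  have : κ ^ 2 * (u / 2) ≤ κ ^ 2 * ∑' x, h x ^ 2 := by gcongr
  have : 4 * r * Energy σ h ≤ 4 * r * Energy σ f := by gcongr
  linarith

open Classical in
/-- Iterates of the walk started at `x0`. -/
noncomputable def walk (σ : Fin r → Equiv.Perm X) (x0 : X) : ℕ → X → ℝ
  | 0 => fun x => if x = x0 then 1 else 0
  | n + 1 => Pop σ (walk σ x0 n)

lemma walk_fs (σ : Fin r → Equiv.Perm X) (x0 : X) (n : ℕ) : HasFiniteSupport (walk σ x0 n) := by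
  classical
  induction n with
  | zero =>
    refine Set.Finite.subset (Set.finite_singleton x0) ?_
    intro x hx
    by_contra h
    simp at h
    simp [walk, h] at hx
  | succ n ih => exact Pop_fs σ ih

lemma walk_nonneg (σ : Fin r → Equiv.Perm X) (x0 : X) (n : ℕ) : ∀ x, 0 ≤ walk σ x0 n x := by
  classical
  induction n with
  | zero => intro x; simp only [walk]; split_ifs <;> norm_num
  | succ n ih => exact Pop_nonneg σ ih

lemma walk_tsum (hr : 0 < r) (σ : Fin r → Equiv.Perm X) (x0 : X) (n : ℕ) :
    ∑' x, walk σ x0 n x = 1 := by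
  classical
  induction n with
  | zero => simp [walk]
  | succ n ih => rw [walk, Pop_tsum hr σ (walk_fs σ x0 n), ih]

lemma walk_two (σ : Fin r → Equiv.Perm X) (x0 : X) (n m : ℕ) :
    walk σ x0 (n + m) x0 = ∑' x, walk σ x0 n x * walk σ x0 m x := by
  classical
  induction n generalizing m with
  | zero => simp [walk]
  | succ n ih =>
    have := ih (m + 1)
    rw [show n + 1 + m = n + (m + 1) by ring, this, walk, walk]
    exact (Pop_self_adj σ (walk_fs σ x0 n) (walk_fs σ x0 m)).symm

lemma walk_decay (σ : Fin r → Equiv.Perm X) (hr : 0 < r) (κ : ℝ) (hκ : 0 < κ) (v : ℝ) (hv : 0 < v)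
    (hA : ∀ U : Finset X, (U.card : ℝ) < v → κ * U.card ≤ bd σ U) (x0 : X) (n : ℕ) :
    walk σ x0 (2 * n) x0 ≤ max (4 / v) (Real.exp (-(κ ^ 2 / (32 * r ^ 2)) * n)) := by
  have hr' : (0:ℝ) < r := by exact_mod_cast hr
  rw [two_mul, walk_two]
  simp_rw [← sq]
  induction n with
  | zero =>
    classical
    apply le_max_of_le_right
    have : ∀ x, walk σ x0 0 x ^ 2 = walk σ x0 0 x := by
      intro x; simp only [walk]; split_ifs <;> norm_num
    simp_rw [this]
    rw [walk_tsum hr]; simp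
  | succ n ih =>
    set u := ∑' x, walk σ x0 n x ^ 2 with hu
    have hle := Pop_norm_le hr σ (walk_fs σ x0 n)
    have hEn : 0 ≤ Energy σ (walk σ x0 n) :=
      Finset.sum_nonneg fun j _ => tsum_nonneg fun x => sq_nonneg _
    change ∑' x, walk σ x0 (n+1) x ^ 2 ≤ u - _ at hle
    by_cases hc : 4 < v * u
    · have na := nash σ hr κ hκ v hA _ (walk_nonneg σ x0 n) (walk_fs σ x0 n) (walk_tsum hr σ x0 n) hc
      rw [← hu] at na
      have hu4 : 4 / v < u := by rw [div_lt_iff₀ hv]; linarith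
      have ihe : u ≤ Real.exp (-(κ ^ 2 / (32 * r ^ 2)) * n) := by
        rcases le_max_iff.1 ih with h | h
        · linarith
        · exact h
      apply le_max_of_le_right
      have hu0 : 0 ≤ u := tsum_nonneg fun x => sq_nonneg _
      calc _ ≤ u - 1 / (4 * r) * Energy σ (walk σ x0 n) := hle
        _ ≤ u - (κ ^ 2 / (32 * r ^ 2)) * u := by
          have : (κ ^ 2 / (32 * r ^ 2)) * u = 1 / (4 * r) * ((κ ^ 2 * u) / (8 * r)) := by
            field_simp; ring
          rw [this]
          gcongr
          rw [div_le_iff₀ (by positivity)]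
          linarith
        _ = (1 - (κ ^ 2 / (32 * r ^ 2))) * u := by ring
        _ ≤ Real.exp (-(κ ^ 2 / (32 * r ^ 2))) * u := by
          gcongr
          have := Real.add_one_le_exp (-(κ ^ 2 / (32 * (r:ℝ) ^ 2)))
          linarith
        _ ≤ Real.exp (-(κ ^ 2 / (32 * r ^ 2))) * Real.exp (-(κ ^ 2 / (32 * r ^ 2)) * n) := by gcongr
        _ = _ := by
          rw [← Real.exp_add]
          congr 1
          push_cast
          ring
    · push Not at hc
      apply le_max_of_le_left
      have : u ≤ 4 / v := by rw [le_div_iff₀ hv]; linarith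
      have : 0 ≤ 1 / (4 * r) * Energy σ (walk σ x0 n) := by positivity
      linarith

end cheeger

section comb
variable {X : Type*} {r : ℕ}

lemma dU_one (U : Finset X) : dU U 1 = 0 := by
  classical
  unfold dU
  rw [Finset.card_eq_zero, Finset.filter_eq_empty_iff]
  intro x hx
  simpa using hx

lemma dU_mul (U : Finset X) (e f : Equiv.Perm X) : dU U (e * f) ≤ dU U f + dU U e := by
  classical
  unfold dU
  have h : (U.filter fun x => (e * f) x ∉ U) ⊆ (U.filter fun x => f x ∉ U) ∪
      ((U.filter fun x => e x ∉ U).image f.symm) := by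
    intro x hx
    obtain ⟨hx1, hx2⟩ := Finset.mem_filter.1 hx
    rw [Finset.mem_union]
    by_cases h : f x ∈ U
    · right
      exact Finset.mem_image.2 ⟨f x, Finset.mem_filter.2 ⟨h, hx2⟩, by simp⟩
    · left; exact Finset.mem_filter.2 ⟨hx1, h⟩
  refine (Finset.card_le_card h).trans ((Finset.card_union_le _ _).trans ?_)
  exact Nat.add_le_add_left Finset.card_image_le _

lemma dU_inv (U : Finset X) (e : Equiv.Perm X) : dU U e⁻¹ = dU U e := by
  classical
  unfold dU
  have h : (U.filter fun x => e⁻¹ x ∈ U).card = (U.filter fun x => e x ∈ U).card := by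
    refine Finset.card_bij (fun x _ => e⁻¹ x) ?_ ?_ ?_
    · intro x hx
      simp only [Finset.mem_filter] at *
      exact ⟨hx.2, by simpa using hx.1⟩
    · intro a _ b _ h; exact (e⁻¹).injective h
    · intro y hy
      simp only [Finset.mem_filter] at *
      exact ⟨e y, ⟨hy.2, by simpa using hy.1⟩, by simp⟩
  have h1 := Finset.card_filter_add_card_filter_not (s := U) (fun x => e⁻¹ x ∈ U)
  have h2 := Finset.card_filter_add_card_filter_not (s := U) (fun x => e x ∈ U)
  omega

/-- Permutations whose boundary is controlled by the total boundary. -/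
def Ctrl (σ : Fin r → Equiv.Perm X) : Subgroup (Equiv.Perm X) where
  carrier := {e | ∃ C : ℕ, ∀ U : Finset X, dU U e ≤ C * bd σ U}
  one_mem' := ⟨0, fun U => by simp [dU_one]⟩
  mul_mem' := by
    rintro a b ⟨C, hC⟩ ⟨C', hC'⟩
    refine ⟨C' + C, fun U => ?_⟩
    have := dU_mul U a b
    have := hC U
    have := hC' U
    rw [add_mul]; omega
  inv_mem' := by
    rintro a ⟨C, hC⟩
    exact ⟨C, fun U => by rw [dU_inv]; exact hC U⟩

lemma mem_Ctrl_iff (σ : Fin r → Equiv.Perm X) (e : Equiv.Perm X) :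
    e ∈ Ctrl σ ↔ ∃ C : ℕ, ∀ U : Finset X, dU U e ≤ C * bd σ U := Iff.rfl

lemma gen_mem_Ctrl (σ : Fin r → Equiv.Perm X) (j : Fin r) : σ j ∈ Ctrl σ := by
  refine ⟨1, fun U => ?_⟩
  rw [one_mul]
  exact Finset.single_le_sum (f := fun j => dU U (σ j)) (fun _ _ => Nat.zero_le _) (Finset.mem_univ j)

lemma piecewise_mem_Ctrl (σ : Fin r → Equiv.Perm X) (e : Equiv.Perm X) {ι : Type*} (s : Finset ι)
    (f : ι → Equiv.Perm X) (hf : ∀ i ∈ s, f i ∈ Ctrl σ) (he : ∀ x, ∃ i ∈ s, e x = f i x) :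
    e ∈ Ctrl σ := by
  classical
  have : ∀ i, ∃ C : ℕ, i ∈ s → ∀ U : Finset X, dU U (f i) ≤ C * bd σ U := by
    intro i
    by_cases hi : i ∈ s
    · obtain ⟨C, hC⟩ := hf i hi; exact ⟨C, fun _ => hC⟩
    · exact ⟨0, fun h => absurd h hi⟩
  choose C hC using this
  refine ⟨∑ i ∈ s, C i, fun U => ?_⟩
  rw [Finset.sum_mul]
  refine le_trans ?_ (Finset.sum_le_sum fun i hi => hC i hi U)
  unfold dU
  refine le_trans (Finset.card_le_card ?_) (Finset.card_biUnion_le (s := s)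
    (t := fun i => U.filter (fun x => f i x ∉ U)))
  intro x hx
  simp only [Finset.mem_filter, Finset.mem_biUnion] at *
  obtain ⟨i, hi, h⟩ := he x
  exact ⟨i, hi, hx.1, h ▸ hx.2⟩

open Classical in
lemma averaging {ι : Type*} (I : Finset ι) (hI : I.Nonempty) (p : ι → Equiv.Perm X)
    (U U' : Finset X) (hU' : U' ⊆ U) (E : ℕ) (hE : ∀ i ∈ I, dU U (p i) ≤ E)
    (h : ∀ x ∈ U', 2 * (I.filter fun i => p i x ∈ U).card ≤ I.card) : U'.card ≤ 2 * E := by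
  have h1 : ∑ x ∈ U', (I.filter fun i => p i x ∉ U).card ≤ I.card * E := by
    rw [show ∑ x ∈ U', (I.filter fun i => p i x ∉ U).card =
      ∑ i ∈ I, (U'.filter fun x => p i x ∉ U).card from
        Finset.sum_card_bipartiteAbove_eq_sum_card_bipartiteBelow (fun x i => p i x ∉ U)]
    rw [← smul_eq_mul]
    refine Finset.sum_le_card_nsmul _ _ _ fun i hi => le_trans ?_ (hE i hi)
    exact Finset.card_le_card (Finset.filter_subset_filter _ hU')
  have h2 : U'.card * I.card ≤ 2 * ∑ x ∈ U', (I.filter fun i => p i x ∉ U).card := by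
    rw [Finset.mul_sum, ← smul_eq_mul]
    refine Finset.card_nsmul_le_sum _ _ _ fun x hx => ?_
    have := h x hx
    have := Finset.card_filter_add_card_filter_not (s := I) (fun i => p i x ∈ U)
    omega
  have hpos := hI.card_pos
  have : U'.card * I.card ≤ (2 * E) * I.card := by nlinarith
  exact Nat.le_of_mul_le_mul_right this hpos

open Classical in
lemma fiber_card_bound {A : Type*} (p : X → A) (U U1 : Finset X) (a : ℕ)
    (h : ∀ x ∈ U1, a ≤ (U.filter fun y => p y = p x).card) :
    a * (U1.image p).card ≤ U.card := by
  have h1 : ∑ b ∈ U1.image p, (U.filter fun y => p y = b).card ≤ U.card := by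
    rw [← Finset.card_biUnion]
    · refine Finset.card_le_card ?_
      intro x hx
      simp only [Finset.mem_biUnion, Finset.mem_filter] at hx
      obtain ⟨_, _, hx, _⟩ := hx
      exact hx
    · intro b _ b' _ hbb
      rw [Function.onFun, Finset.disjoint_left]
      intro x hx hx'
      simp only [Finset.mem_filter] at hx hx'
      exact hbb (hx.2.symm.trans hx'.2)
  refine le_trans ?_ h1
  rw [mul_comm, ← smul_eq_mul]
  refine Finset.card_nsmul_le_sum _ _ _ fun b hb => ?_
  obtain ⟨x, hx, rfl⟩ := Finset.mem_image.1 hb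
  exact h x hx

open Classical in
lemma peel_aux {C : Type*} (V : Finset X) (p : X → C) (x : X) (hx : x ∈ V) :
      ((V.filter fun y => ¬ p y = p x).image p).card + 1 ≤ (V.image p).card := by
  have : p x ∉ (V.filter fun y => ¬ p y = p x).image p := by
    intro h
    obtain ⟨y, hy, h⟩ := Finset.mem_image.1 h
    exact (Finset.mem_filter.1 hy).2 h
  rw [← Finset.card_insert_of_notMem this]
  refine Finset.card_le_card ?_
  intro c hc
  rcases Finset.mem_insert.1 hc with h | h
  · rw [h]; exact Finset.mem_image_of_mem _ hx
  · exact Finset.image_subset_image (Finset.filter_subset _ _) h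

open Classical in
lemma peel_aux2 {C : Type*} (V W : Finset X) (p : X → C) (s : W ⊆ V) :
      (W.image p).card ≤ (V.image p).card :=
  Finset.card_le_card (Finset.image_subset_image s)

open Classical in
lemma peel {A B : Type*} (p : X → A) (q : X → B) (U U1 : Finset X) (h1 : U1 ⊆ U)
    (hU : 0 < U.card) (h34 : 3 * U.card ≤ 4 * U1.card) (a b : ℕ)
    (ha : ∀ x ∈ U1, a ≤ (U.filter fun y => p y = p x).card)
    (hb : ∀ x ∈ U1, b ≤ (U.filter fun y => q y = q x).card) :
    ∃ V ⊆ U, V.Nonempty ∧ (∀ x ∈ V, a ≤ 4 * (V.filter fun y => p y = p x).card) ∧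
      (∀ x ∈ V, b ≤ 4 * (V.filter fun y => q y = q x).card) := by
  let Φ : Finset X → ℤ := fun V => 4 * V.card - a * (V.image p).card - b * (V.image q).card
  obtain ⟨V, hV, hmax⟩ := Finset.exists_max_image U.powerset Φ ⟨U1, by simpa using h1⟩
  have hV' : V ⊆ U := by simpa using hV
  have hΦ1 : 0 < Φ U1 := by
    have e1 := fiber_card_bound p U U1 a ha
    have e2 := fiber_card_bound q U U1 b hb
    simp only [Φ]
    zify at e1 e2 h34 hU
    linarith
  have hΦV : 0 < Φ V := lt_of_lt_of_le hΦ1 (hmax U1 (by simpa using h1))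
  refine ⟨V, hV', ?_, ?_, ?_⟩
  · by_contra h
    rw [Finset.not_nonempty_iff_eq_empty] at h
    simp [Φ, h] at hΦV
  · intro x hx
    by_contra hc
    push Not at hc
    have m := hmax (V.filter fun y => ¬ p y = p x) (by
      simp only [Finset.mem_powerset]; exact (Finset.filter_subset _ _).trans hV')
    have g1 := peel_aux V p x hx
    have g2 := peel_aux2 V (V.filter fun y => ¬ p y = p x) q (Finset.filter_subset _ _)
    have g3 : (V.filter fun y => p y = p x).card + (V.filter fun y => ¬ p y = p x).card = V.card := by
      have := Finset.card_filter_add_card_filter_not (s := V) (fun y => p y = p x)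
      convert this
    simp only [Φ] at m
    zify at g1 g2 g3 hc
    have k1 := mul_le_mul_of_nonneg_left g1 (Int.natCast_nonneg a)
    have k2 := mul_le_mul_of_nonneg_left g2 (Int.natCast_nonneg b)
    linarith
  · intro x hx
    by_contra hc
    push Not at hc
    have m := hmax (V.filter fun y => ¬ q y = q x) (by
      simp only [Finset.mem_powerset]; exact (Finset.filter_subset _ _).trans hV')
    have g1 := peel_aux V q x hx
    have g2 := peel_aux2 V (V.filter fun y => ¬ q y = q x) p (Finset.filter_subset _ _)
    have g3 : (V.filter fun y => q y = q x).card + (V.filter fun y => ¬ q y = q x).card = V.card := by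
      have := Finset.card_filter_add_card_filter_not (s := V) (fun y => q y = q x)
      convert this
    simp only [Φ] at m
    zify at g1 g2 g3 hc
    have k1 := mul_le_mul_of_nonneg_left g1 (Int.natCast_nonneg b)
    have k2 := mul_le_mul_of_nonneg_left g2 (Int.natCast_nonneg a)
    linarith

open Classical in
lemma cube {G : Type*} (M : ℕ) (Y : Finset G) : ∀ (K : ℕ) (V : Finset (G → ℤ)), V.Nonempty →
    (∀ ψ ∈ V, K ≤ (Y.filter fun t => M ≤ (V.filter fun ψ' => ∀ s, s ≠ t → ψ' s = ψ s).card).card) →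
    M ^ K ≤ V.card := by
  induction Y using Finset.induction_on with
  | empty =>
    intro K V hV h
    obtain ⟨ψ, hψ⟩ := hV
    have := h ψ hψ
    simp at this
    subst this
    simpa using Finset.card_pos.2 ⟨ψ, hψ⟩
  | insert t0 Y ht0 ih =>
    intro K V hV h
    by_cases hgood : ∃ ψ ∈ V, M ≤ (V.filter fun ψ' => ∀ s, s ≠ t0 → ψ' s = ψ s).card
    · obtain ⟨ψ0, hψ0, hM0⟩ := hgood
      rcases K with _ | K
      · simpa using hV.card_pos
      set L := (V.filter fun ψ' => ∀ s, s ≠ t0 → ψ' s = ψ0 s) with hL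
      have hinj : Set.InjOn (fun ψ : G → ℤ => ψ t0) L := by
        intro a ha b hb hab
        simp only [hL, Finset.coe_filter, Set.mem_ofPred_eq] at ha hb
        funext s
        by_cases hs : s = t0
        · rw [hs]; exact hab
        · rw [ha.2 s hs, hb.2 s hs]
      have slice : ∀ x ∈ L.image (fun ψ => ψ t0), M ^ K ≤ (V.filter fun ψ => ψ t0 = x).card := by
        intro x hx
        apply ih
        · obtain ⟨ψ, hψ, rfl⟩ := Finset.mem_image.1 hx
          exact ⟨ψ, by simp [(Finset.mem_filter.1 hψ).1]⟩
        · intro ψ hψ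
          have hψ' := Finset.mem_filter.1 hψ
          have h1 := h ψ hψ'.1
          rw [Finset.filter_insert] at h1
          have h2 : K ≤ (Y.filter fun t => M ≤ (V.filter fun ψ' => ∀ s, s ≠ t → ψ' s = ψ s).card).card := by
            split_ifs at h1
            · have := Finset.card_insert_le t0 (Y.filter fun t => M ≤ (V.filter fun ψ' => ∀ s, s ≠ t → ψ' s = ψ s).card)
              omega
            · omega
          refine h2.trans (Finset.card_le_card ?_)
          intro t ht
          simp only [Finset.mem_filter] at ht ⊢
          refine ⟨ht.1, ht.2.trans (Finset.card_le_card ?_)⟩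
          intro χ hχ
          simp only [Finset.mem_filter] at hχ ⊢
          refine ⟨⟨hχ.1, ?_⟩, hχ.2⟩
          rw [hχ.2 t0 (by rintro rfl; exact ht0 ht.1)]
          exact hψ'.2
      have h1 : ∑ b ∈ L.image (fun ψ => ψ t0), (V.filter fun y => y t0 = b).card ≤ V.card := by
        rw [← Finset.card_biUnion]
        · refine Finset.card_le_card ?_
          intro x hx
          simp only [Finset.mem_biUnion, Finset.mem_filter] at hx
          obtain ⟨_, _, hx, _⟩ := hx
          exact hx
        · intro b _ b' _ hbb
          rw [Function.onFun, Finset.disjoint_left]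
          intro x hx hx'
          simp only [Finset.mem_filter] at hx hx'
          exact hbb (hx.2.symm.trans hx'.2)
      have h2 := Finset.card_nsmul_le_sum _ _ _ slice
      rw [Finset.card_image_of_injOn hinj, smul_eq_mul] at h2
      calc M ^ (K + 1) = M * M ^ K := by ring
        _ ≤ L.card * M ^ K := by gcongr
        _ ≤ _ := h2.trans h1
    · push Not at hgood
      apply ih K V hV
      intro ψ hψ
      have h1 := h ψ hψ
      rw [Finset.filter_insert, if_neg (by have := hgood ψ hψ; omega)] at h1
      exact h1

end comb

lemma mem_filter_any {α : Type*} {p : α → Prop} {dec : DecidablePred p} {s : Finset α} {a : α}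
    (h : a ∈ @Finset.filter α p dec s) : a ∈ s ∧ p a := Finset.mem_filter.1 h

section fk
variable {G : Type*} [Group G] {r : ℕ}

/-- Base translation on the lamp space. -/
def bHom : G →* Equiv.Perm ((G → ℤ) × G) where
  toFun g :=
    { toFun := fun x => (x.1, g * x.2)
      invFun := fun x => (x.1, g⁻¹ * x.2)
      left_inv := fun x => by simp
      right_inv := fun x => by simp }
  map_one' := by ext x <;> simp
  map_mul' a b := by ext x <;> simp [mul_assoc]

@[simp] lemma bHom_apply (g : G) (x : (G → ℤ) × G) : bHom g x = (x.1, g * x.2) := rfl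

open Classical in
/-- The lamp switch at the nearest net point. -/
def lamp (τ : G → G) : Equiv.Perm ((G → ℤ) × G) where
  toFun x := (x.1 + Pi.single (τ x.2) 1, x.2)
  invFun x := (x.1 - Pi.single (τ x.2) 1, x.2)
  left_inv x := by simp
  right_inv x := by simp

open Classical in
lemma lamp_apply (τ : G → G) (x : (G → ℤ) × G) :
    lamp τ x = (x.1 + Pi.single (τ x.2) 1, x.2) := rfl

open Classical in
lemma lamp_pow (τ : G → G) (k : ℕ) (x : (G → ℤ) × G) :
    (lamp τ ^ k) x = (x.1 + Pi.single (τ x.2) (k : ℤ), x.2) := by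
  induction k with
  | zero => simp
  | succ k ih =>
    rw [pow_succ', Equiv.Perm.mul_apply, ih, lamp_apply]
    simp only [Prod.mk.injEq, and_true]
    rw [add_assoc, ← Pi.single_add]
    push_cast; rfl

lemma dU_pow_le {X : Type*} (U : Finset X) (e : Equiv.Perm X) (k : ℕ) : dU U (e ^ k) ≤ k * dU U e := by
  induction k with
  | zero => simp [dU_one]
  | succ k ih =>
    rw [pow_succ]
    have := dU_mul U (e ^ k) e
    rw [add_mul, one_mul]
    omega

open Classical in
/-- Powers of a finite set, with a fixed choice of decidability. -/
def ballF (S : Finset G) (n : ℕ) : Finset G := S ^ n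

open Classical in
lemma ballF_zero (S : Finset G) : ballF S 0 = {1} := pow_zero S

open Classical in
lemma mem_ballF_succ (S : Finset G) (n : ℕ) (g : G) :
    g ∈ ballF S (n + 1) ↔ ∃ a ∈ ballF S n, ∃ b ∈ S, a * b = g := by
  rw [ballF, pow_succ, Finset.mem_mul]; rfl

lemma ballF_coe (S : Finset G) (n : ℕ) : (ballF S n : Set G) = (S : Set G) ^ n := by
  classical
  exact Finset.coe_pow S n

open Classical in
lemma dU_ball (S : Finset G) (U : Finset ((G → ℤ) × G)) (E : ℕ)
    (h : ∀ s ∈ S, dU U (bHom s) ≤ E) (n : ℕ) : ∀ g ∈ S ^ n, dU U (bHom g) ≤ n * E := by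
  induction n with
  | zero =>
    intro g hg
    simp at hg
    subst hg
    simp [dU_one]
  | succ n ih =>
    intro g hg
    rw [pow_succ, Finset.mem_mul] at hg
    obtain ⟨a, ha, b, hb, rfl⟩ := hg
    rw [map_mul]
    have := dU_mul U (bHom a) (bHom b)
    have := ih a ha
    have := h b hb
    rw [add_mul, one_mul]
    omega

open Classical in
lemma faber_krahn (S : Finset G) (τ : G → G) (w : ℕ)
    (hτ : ∀ t, ∀ Z : Finset G, (∀ z ∈ Z, τ z = t) → Z.card ≤ w) (hS1 : (1 : G) ∈ S)
    (σ : Fin r → Equiv.Perm ((G → ℤ) × G)) (C4 : ℕ)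
    (hb : ∀ s ∈ S, ∀ U, dU U (bHom s) ≤ C4 * bd σ U)
    (hl : ∀ U, dU U (lamp τ) ≤ C4 * bd σ U) (M K : ℕ) (hM : 1 ≤ M)
    (hK : 8 * w * K ≤ (ballF S (4 * M)).card) (U : Finset ((G → ℤ) × G))
    (hU : 96 * C4 * M * bd σ U < U.card) : M ^ K ≤ U.card := by
  change 8 * w * K ≤ (S ^ (4 * M)).card at hK
  have hne : (S ^ (4 * M)).Nonempty := Finset.Nonempty.pow ⟨1, hS1⟩
  have A1 := averaging (S ^ (4 * M)) hne (fun g => bHom g) U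
    (U.filter fun x => 2 * ((S ^ (4 * M)).filter fun g => bHom g x ∈ U).card ≤ (S ^ (4 * M)).card)
    (Finset.filter_subset _ _) (4 * M * (C4 * bd σ U))
    (fun g hg => dU_ball S U _ (fun s hs => hb s hs U) _ g hg)
    (fun x hx => by have h := (Finset.mem_filter.1 hx).2; convert h)
  have A2 := averaging (Finset.range (8 * M)) ⟨0, by simp; omega⟩ (fun k => lamp τ ^ k) U
    (U.filter fun x => 2 * ((Finset.range (8 * M)).filter fun k => (lamp τ ^ k) x ∈ U).card
      ≤ (Finset.range (8 * M)).card)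
    (Finset.filter_subset _ _) (8 * M * (C4 * bd σ U))
    (fun k hk => (dU_pow_le U _ k).trans (by
      have h1 := (Finset.mem_range.1 hk).le
      exact Nat.mul_le_mul h1 (hl U)))
    (fun x hx => by have h := (Finset.mem_filter.1 hx).2; convert h)
  set U' := (U.filter fun x => 2 * ((S ^ (4 * M)).filter fun g => bHom g x ∈ U).card ≤ (S ^ (4 * M)).card) with hU'
  set U'' := (U.filter fun x => 2 * ((Finset.range (8 * M)).filter fun k => (lamp τ ^ k) x ∈ U).card
      ≤ (Finset.range (8 * M)).card) with hU''
  set U1 := U \ (U' ∪ U'') with hU1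
  have hc1 : U.card ≤ U1.card + (U'.card + U''.card) := by
    have h1 : U ⊆ U1 ∪ (U' ∪ U'') := by
      intro x hx
      rw [hU1, Finset.sdiff_union_self_eq_union]
      exact Finset.mem_union_left _ hx
    exact (Finset.card_le_card h1).trans ((Finset.card_union_le _ _).trans
      (Nat.add_le_add_left (Finset.card_union_le _ _) _))
  have hmul : 96 * C4 * M * bd σ U = 96 * (M * (C4 * bd σ U)) := by ring
  have e1 : 4 * M * (C4 * bd σ U) = 4 * (M * (C4 * bd σ U)) := by ring
  have e2 : 8 * M * (C4 * bd σ U) = 8 * (M * (C4 * bd σ U)) := by ring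
  rw [e1] at A1
  rw [e2] at A2
  rw [hmul] at hU
  have h34 : 3 * U.card ≤ 4 * U1.card := by omega
  obtain ⟨V, hVU, hVne, hVp, hVq⟩ := peel (fun x : (G → ℤ) × G => x.1)
    (fun x : (G → ℤ) × G => (x.2, Function.update x.1 (τ x.2) 0)) U U1 Finset.sdiff_subset
    (by omega) h34 (4 * (w * K)) (4 * M) (by
      intro x hx
      have hx' := Finset.mem_sdiff.1 hx
      have h1 : x ∉ U' := fun h => hx'.2 (Finset.mem_union_left _ h)
      rw [hU', Finset.mem_filter] at h1
      push Not at h1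
      have h2 := h1 hx'.1
      have h3 : ((S ^ (4 * M)).filter fun g => bHom g x ∈ U).card ≤
          (U.filter fun y => y.1 = x.1).card := by
        refine Finset.card_le_card_of_injOn (fun g => bHom g x) ?_ ?_
        · intro g hg
          have hg := (Finset.mem_filter.1 hg).2
          simp only [Finset.coe_filter, Set.mem_ofPred_eq]
          exact ⟨hg, rfl⟩
        · intro g _ g' _ h
          simpa using h
      have h4 : 8 * w * K = 8 * (w * K) := by ring
      omega)
    (by
      intro x hx
      have hx' := Finset.mem_sdiff.1 hx
      have h1 : x ∉ U'' := fun h => hx'.2 (Finset.mem_union_right _ h)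
      rw [hU'', Finset.mem_filter] at h1
      push Not at h1
      have h2 := h1 hx'.1
      rw [Finset.card_range] at h2
      refine le_trans (b := ((Finset.range (8 * M)).filter fun k => (lamp τ ^ k) x ∈ U).card) (by omega) ?_
      · refine Finset.card_le_card_of_injOn (fun k => (lamp τ ^ k) x) ?_ ?_
        · intro g hg
          have hg := (Finset.mem_filter.1 hg).2
          simp only [Finset.coe_filter, Set.mem_ofPred_eq]
          refine ⟨hg, ?_⟩
          rw [lamp_pow]
          simp only [Prod.mk.injEq, true_and]
          funext s
          by_cases hs : s = τ x.2
          · subst hs; simp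
          · simp [Function.update_of_ne hs, Pi.single_eq_of_ne hs]
        · intro g _ g' _ h
          simp only [lamp_pow, Prod.mk.injEq, and_true, add_right_inj] at h
          have := congrFun h (τ x.2)
          simpa using this)
  have hcube := cube M (V.image fun x => τ x.2) K (V.image fun x => x.1) (hVne.image _) (by
    intro ψ hψ
    obtain ⟨x, hx, rfl⟩ := Finset.mem_image.1 hψ
    have h1 := hVp x hx
    have hsub : ((V.filter fun y => y.1 = x.1).image fun y => τ y.2) ⊆
        ((V.image fun x => τ x.2).filter fun t => M ≤ ((V.image fun x => x.1).filter fun ψ' => ∀ s, s ≠ t → ψ' s = x.1 s).card) := by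
      intro t ht
      obtain ⟨y, hy, rfl⟩ := Finset.mem_image.1 ht
      obtain ⟨hyV, hyx⟩ := Finset.mem_filter.1 hy
      rw [Finset.mem_filter]
      refine ⟨Finset.mem_image_of_mem _ hyV, ?_⟩
      have h2 := hVq y hyV
      have h3 : ∀ Z : Finset ((G → ℤ) × G), (∀ z ∈ Z, z ∈ V ∧ ((z.2, Function.update z.1 (τ z.2) 0) : G × (G → ℤ)) = (y.2, Function.update y.1 (τ y.2) 0)) →
          Z.card ≤ ((V.image fun x => x.1).filter fun ψ' => ∀ s, s ≠ τ y.2 → ψ' s = x.1 s).card := by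
        intro Z hZ
        refine Finset.card_le_card_of_injOn (fun z => z.1) ?_ ?_
        · intro z hz
          obtain ⟨hz1, hz2⟩ := hZ z hz
          simp only [Finset.coe_filter, Set.mem_ofPred_eq]
          refine ⟨Finset.mem_image_of_mem _ hz1, fun s hs => ?_⟩
          simp only [Prod.mk.injEq] at hz2
          have h5 := congrFun hz2.2 s
          rw [hz2.1, Function.update_of_ne hs, Function.update_of_ne hs] at h5
          rw [h5, hyx]
        · intro z hz z' hz' h
          obtain ⟨_, hz2⟩ := hZ z hz
          obtain ⟨_, hz2'⟩ := hZ z' hz'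
          simp only [Prod.mk.injEq] at hz2 hz2'
          exact Prod.ext h (hz2.1.trans hz2'.1.symm)
      have h8 := Nat.le_trans h2 (Nat.mul_le_mul_left 4 (h3 _ (fun z hz => mem_filter_any hz)))
      omega
    have hcard : (V.filter fun y => y.1 = x.1).card ≤
        w * ((V.filter fun y => y.1 = x.1).image fun y => τ y.2).card := by
      refine Finset.card_le_mul_card_image _ _ ?_
      intro t _
      have h6 := hτ t ((((V.filter fun y => y.1 = x.1)).filter fun y => τ y.2 = t).image fun y => y.2) (by
        intro z hz
        obtain ⟨y, hy, rfl⟩ := Finset.mem_image.1 hz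
        exact (Finset.mem_filter.1 hy).2)
      rw [Finset.card_image_of_injOn] at h6
      · exact h6
      · intro y hy y' hy' h
        have hy := (Finset.mem_filter.1 (Finset.mem_filter.1 hy).1).2
        have hy' := (Finset.mem_filter.1 (Finset.mem_filter.1 hy').1).2
        exact Prod.ext (hy.trans hy'.symm) h
    refine le_trans ?_ (Finset.card_le_card hsub)
    have h7 : w * K ≤ w * ((V.filter fun y => y.1 = x.1).image fun y => τ y.2).card := by omega
    have hw : 0 < w := by
      have := hτ (τ 1) {1} (by simp)
      rw [Finset.card_singleton] at this
      exact this
    exact Nat.le_of_mul_le_mul_left h7 hw)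
  exact hcube.trans (Finset.card_image_le.trans (Finset.card_le_card hVU))

end fk

lemma free_not_nilpotent (r : ℕ) (hr : 2 ≤ r) (h : Group.IsNilpotent (FreeGroup (Fin r))) : False := by
  let c : Equiv.Perm (Fin 5) := finRotate 5
  let s : Equiv.Perm (Fin 5) := Equiv.swap 0 (c 0)
  have hcl : Subgroup.closure ({c, s} : Set (Equiv.Perm (Fin 5))) = ⊤ :=
    Equiv.Perm.closure_cycle_adjacent_swap (isCycle_finRotate (n := 3)) support_finRotate 0
  let f : Fin r → Equiv.Perm (Fin 5) := fun i => if i.1 = 0 then c else s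
  have hsurj : Function.Surjective (FreeGroup.lift f) := by
    rw [FreeGroup.lift_surjective_iff_closure_range_eq_top]
    rw [eq_top_iff, ← hcl, Subgroup.closure_le]
    intro x hx
    apply Subgroup.subset_closure
    rcases hx with hx | hx
    · exact ⟨⟨0, by omega⟩, by simp [f, hx]⟩
    · rw [Set.mem_singleton_iff] at hx
      exact ⟨⟨1, by omega⟩, by simp [f, hx]⟩
  haveI : Group.IsSolvable (FreeGroup (Fin r)) := inferInstance
  exact Equiv.Perm.not_isSolvable_fin_5 (Group.isSolvable_of_surjective hsurj)

lemma N_ne_bot (r : ℕ) (hr : 2 ≤ r) (N : Subgroup (FreeGroup (Fin r))) [N.Normal]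
    (h : Group.IsNilpotent (FreeGroup (Fin r) ⧸ N)) : ∃ w ∈ N, w ≠ 1 := by
  by_contra hc
  push Not at hc
  have hN : N = ⊥ := by
    rw [eq_bot_iff]; intro x hx; exact hc x hx
  subst hN
  apply free_not_nilpotent r hr
  exact Group.nilpotent_of_mulEquiv (QuotientGroup.quotientBot (G := FreeGroup (Fin r)))

open FreeGroup in
/-- A minimal relator starting with a positive letter. -/
lemma exists_min_relator {r : ℕ} (N : Subgroup (FreeGroup (Fin r))) [N.Normal]
    (h : ∃ w ∈ N, w ≠ 1) : ∃ (i : Fin r) (L : List (Fin r × Bool)),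
      IsReduced ((i, true) :: L) ∧ mk ((i, true) :: L) ∈ N ∧
      ∀ v ∈ N, v.norm < L.length + 1 → v = 1 := by
  classical
  have hex : ∃ n : ℕ, ∃ w ∈ N, w ≠ 1 ∧ w.norm = n := by
    obtain ⟨w, h1, h2⟩ := h; exact ⟨_, w, h1, h2, rfl⟩
  obtain ⟨w, hw1, hw2, hw3⟩ := Nat.find_spec hex
  have hmin : ∀ v ∈ N, v.norm < w.norm → v = 1 := by
    intro v hv hlt
    by_contra hne
    rw [hw3] at hlt
    exact Nat.find_min hex hlt ⟨v, hv, hne, rfl⟩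
  have hred : IsReduced w.toWord := isReduced_toWord
  have hmk : mk w.toWord = w := mk_toWord
  have hlen : w.norm = w.toWord.length := rfl
  rcases hL : w.toWord with _ | ⟨⟨i, b⟩, L⟩
  · exact absurd (toWord_eq_nil_iff.1 hL) hw2
  rw [hL] at hred hmk hlen
  rw [List.length_cons] at hlen
  cases b
  · -- negative letter
    refine ⟨i, invRev L, ?_, ?_, ?_⟩
    rotate_left
    · have : mk ((i, true) :: invRev L) = of i * w⁻¹ * (of i)⁻¹ := by
        rw [← hmk]
        simp only [FreeGroup.of, FreeGroup.inv_mk, FreeGroup.mul_mk]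
        apply FreeGroup.reduce.exact
        apply FreeGroup.reduce.eq_of_red |> fun h => (h _).symm
        rw [invRev_cons]
        have : ([(i, true)] ++ (invRev L ++ invRev [(i, false)]) ++ invRev [(i, true)]) =
          ((i, true) :: invRev L) ++ (i, true) :: (i, !true) :: [] := by simp [invRev]
        rw [this]
        apply Red.Step.to_red
        have := Red.Step.not (L₁ := (i, true) :: invRev L) (x := i) (b := true) (L₂ := [])
        simpa using this
      rw [this]
      exact Subgroup.Normal.conj_mem inferInstance _ (inv_mem hw1) _
    · rw [invRev_length, ← hlen]; exact hmin
    · rename_i r1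
      have hmem : mk ((i, true) :: invRev L) ∈ N := by
        have : mk ((i, true) :: invRev L) = of i * w⁻¹ * (of i)⁻¹ := by
          rw [← hmk]
          have e : mk ((i, false) :: L) = (of i)⁻¹ * mk L := by
            simp [FreeGroup.of, FreeGroup.inv_mk, FreeGroup.mul_mk, invRev]
          have e2 : mk ((i, true) :: invRev L) = of i * (mk L)⁻¹ := by
            simp [FreeGroup.of, FreeGroup.inv_mk, FreeGroup.mul_mk]
          rw [e, e2]; group
        rw [this]
        exact Subgroup.Normal.conj_mem inferInstance _ (inv_mem hw1) _
      have hne : mk ((i, true) :: invRev L) ≠ 1 := by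
        intro h1
        apply hw2
        rw [← hmk]
        have e : mk ((i, false) :: L) = (of i)⁻¹ * mk L := by
          simp [FreeGroup.of, FreeGroup.inv_mk, FreeGroup.mul_mk, invRev]
        have e2 : mk ((i, true) :: invRev L) = of i * (mk L)⁻¹ := by
          simp [FreeGroup.of, FreeGroup.inv_mk, FreeGroup.mul_mk]
        rw [e2] at h1
        rw [e, mul_inv_eq_one.1 h1]; group
      have hge : w.norm ≤ (mk ((i, true) :: invRev L)).norm := by
        by_contra hlt
        push Not at hlt
        exact hne (hmin _ hmem hlt)
      rw [isReduced_iff_reduce_eq]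
      have hsub := (FreeGroup.reduce.red (L := (i, true) :: invRev L)).sublist
      apply hsub.eq_of_length_le
      rw [List.length_cons, invRev_length, ← hlen]
      exact hge
  · refine ⟨i, L, hred, ?_, ?_⟩
    · rw [hmk]; exact hw1
    · rw [← hlen]; exact hmin

section lampact
variable {r : ℕ} {G : Type*} [Group G] (π : FreeGroup (Fin r) →* G) (i0 : Fin r) (T : Set G)

open Classical in
/-- lamp increment -/
def linc (j : Fin r) (g : G) : G → ℤ := if j = i0 ∧ g ∈ T then Pi.single g 1 else 0

/-- The generator permutations of the lamp space. -/
def genPerm (j : Fin r) : Equiv.Perm ((G → ℤ) × G) where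
  toFun x := (x.1 + linc i0 T j x.2, π (FreeGroup.of j) * x.2)
  invFun x := (x.1 - linc i0 T j ((π (FreeGroup.of j))⁻¹ * x.2), (π (FreeGroup.of j))⁻¹ * x.2)
  left_inv x := by simp
  right_inv x := by simp

lemma genPerm_apply (j : Fin r) (x : (G → ℤ) × G) :
    genPerm π i0 T j x = (x.1 + linc i0 T j x.2, π (FreeGroup.of j) * x.2) := rfl

lemma genPerm_inv_apply (j : Fin r) (x : (G → ℤ) × G) :
    (genPerm π i0 T j)⁻¹ x =
      (x.1 - linc i0 T j ((π (FreeGroup.of j))⁻¹ * x.2), (π (FreeGroup.of j))⁻¹ * x.2) := rfl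

/-- The action of the free group on the lamp space. -/
def Phi : FreeGroup (Fin r) →* Equiv.Perm ((G → ℤ) × G) := FreeGroup.lift (genPerm π i0 T)

lemma Phi_of (j : Fin r) : Phi π i0 T (FreeGroup.of j) = genPerm π i0 T j := by simp [Phi]

lemma Phi_spec (w : FreeGroup (Fin r)) : ∀ x : (G → ℤ) × G, (Phi π i0 T w x).2 = π w * x.2 ∧
    ∀ χ, Phi π i0 T w (x.1 + χ, x.2) = ((Phi π i0 T w x).1 + χ, π w * x.2) := by
  induction w using FreeGroup.induction_on with
  | C1 => intro x; simp
  | of j =>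
    intro x
    rw [Phi_of]
    simp only [genPerm_apply, true_and]
    intro χ
    rw [add_right_comm]
  | inv_of j ih =>
    intro x
    rw [map_inv, Phi_of, map_inv]
    simp only [genPerm_inv_apply, true_and]
    intro χ
    rw [add_sub_right_comm]
  | mul a b iha ihb =>
    intro x
    rw [map_mul, map_mul, Equiv.Perm.mul_apply]
    refine ⟨by rw [(iha _).1, (ihb _).1, mul_assoc], fun χ => ?_⟩
    rw [Equiv.Perm.mul_apply, (ihb x).2 χ, ← (ihb x).1, (iha _).2 χ, (ihb x).1, mul_assoc]

lemma Phi_snd (w : FreeGroup (Fin r)) (x : (G → ℤ) × G) : (Phi π i0 T w x).2 = π w * x.2 :=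
  (Phi_spec π i0 T w x).1

lemma Phi_comm (N : Subgroup (FreeGroup (Fin r))) (hN : N ≤ π.ker) :
    ⁅N, N⁆ ≤ (Phi π i0 T).ker := by
  rw [Subgroup.commutator_le]
  intro a ha b hb
  rw [MonoidHom.mem_ker, map_commutatorElement, commutatorElement_eq_one_iff_mul_comm]
  have ha' : π a = 1 := hN ha
  have hb' : π b = 1 := hN hb
  ext1 x
  have key : ∀ c, π c = 1 → ∀ x : (G → ℤ) × G,
      Phi π i0 T c x = (x.1 + (Phi π i0 T c (0, x.2)).1, x.2) := by
    intro c hc x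
    have := (Phi_spec π i0 T c (0, x.2)).2 x.1
    simp only [zero_add, hc, one_mul] at this
    rw [show x = (x.1, x.2) from rfl, this]
    simp [add_comm]
  rw [Equiv.Perm.mul_apply, Equiv.Perm.mul_apply]
  rw [key a ha' (Phi π i0 T b x), key b hb' (Phi π i0 T a x), key b hb' x, key a ha' x]
  simp only [Prod.mk.injEq, and_true]
  abel

end lampact

section bypass
open FreeGroup
variable {r : ℕ} (N : Subgroup (FreeGroup (Fin r))) [N.Normal]

/-- images of short words -/
def shortSet (ℓ : ℕ) : Set (FreeGroup (Fin r) ⧸ N) :=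
  {g | ∃ w : FreeGroup (Fin r), w.norm ≤ ℓ ∧ (w : FreeGroup (Fin r) ⧸ N) = g}

lemma shortSet_finite (ℓ : ℕ) : (shortSet N ℓ).Finite := by
  have h : {L : List (Fin r × Bool) | L.length ≤ ℓ}.Finite := List.finite_length_le _ ℓ
  refine (h.image (fun L => ((mk L : FreeGroup (Fin r)) : FreeGroup (Fin r) ⧸ N))).subset ?_
  rintro g ⟨w, hw, rfl⟩
  exact ⟨w.toWord, hw, by simp [mk_toWord]⟩

lemma shortSet_one (ℓ : ℕ) : (1 : FreeGroup (Fin r) ⧸ N) ∈ shortSet N ℓ :=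
  ⟨1, by simp, rfl⟩

lemma shortSet_inv (ℓ : ℕ) (g) (hg : g ∈ shortSet N ℓ) : g⁻¹ ∈ shortSet N ℓ := by
  obtain ⟨w, hw, rfl⟩ := hg
  exact ⟨w⁻¹, by rwa [norm_inv_eq], rfl⟩

lemma exists_net (W : Set (FreeGroup (Fin r) ⧸ N)) (h1 : 1 ∈ W) (hinv : ∀ g ∈ W, g⁻¹ ∈ W) :
    ∃ T : Set (FreeGroup (Fin r) ⧸ N), (∀ t ∈ T, ∀ t' ∈ T, t' * t⁻¹ ∈ W → t' = t) ∧
      ∀ g, ∃ t ∈ T, g * t⁻¹ ∈ W := by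
  obtain ⟨T, hT⟩ := zorn_subset {T : Set (FreeGroup (Fin r) ⧸ N) |
      ∀ t ∈ T, ∀ t' ∈ T, t' * t⁻¹ ∈ W → t' = t} (by
    intro c hc hchain
    refine ⟨⋃₀ c, ?_, fun s hs => Set.subset_sUnion_of_mem hs⟩
    rintro t ⟨s, hs, hts⟩ t' ⟨s', hs', hts'⟩
    rcases hchain.total hs hs' with h | h
    · exact hc hs' t (h hts) t' hts'
    · exact hc hs t hts t' (h hts'))
  refine ⟨T, hT.prop, fun g => ?_⟩
  by_contra hno
  push Not at hno
  have hins : insert g T ∈ {T : Set (FreeGroup (Fin r) ⧸ N) |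
      ∀ t ∈ T, ∀ t' ∈ T, t' * t⁻¹ ∈ W → t' = t} := by
    rintro t (rfl | ht) t' (rfl | ht') h
    · rfl
    · exact absurd (by simpa using hinv _ h) (hno t' ht')
    · exact absurd h (hno t ht)
    · exact hT.prop t ht t' ht' h
  have := hT.le_of_ge hins (Set.subset_insert _ _) (Set.mem_insert g T)
  exact hno g this (by simpa using h1)

lemma mk_cons (a : Fin r × Bool) (L : List (Fin r × Bool)) : (mk (a :: L) : FreeGroup (Fin r)) =
    mk [a] * mk L := by rw [mul_mk]; rfl

lemma reduced_part (L1 L2 L3 : List (Fin r × Bool)) (h : IsReduced (L1 ++ L2 ++ L3)) :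
    IsReduced L2 :=
  List.IsChain.right_of_append (List.IsChain.left_of_append h)

lemma bypass (i0 : Fin r) (L : List (Fin r × Bool)) (hred : IsReduced ((i0, true) :: L))
    (hN : mk ((i0, true) :: L) ∈ N) (hmin : ∀ v ∈ N, v.norm < L.length + 1 → v = 1)
    (T : Set (FreeGroup (Fin r) ⧸ N))
    (hT : ∀ t ∈ T, ∀ t' ∈ T, t' * t⁻¹ ∈ shortSet N (L.length + 2) → t' = t)
    (t : FreeGroup (Fin r) ⧸ N) (ht : t ∈ T) (ψ) :
    ∀ u v, L = u ++ v → Phi (QuotientGroup.mk' N) i0 T (mk v) (ψ, (of i0 : FreeGroup (Fin r)) * t) =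
      (ψ, (mk v : FreeGroup (Fin r)) * ((of i0 : FreeGroup (Fin r)) * t)) := by
  intro u v
  induction v generalizing u with
  | nil => intro _; simp [← one_eq_mk]
  | cons a v ih =>
    intro hL
    have ih' := ih (u ++ [a]) (by simp [hL])
    have hvlen : v.length + 1 ≤ L.length := by rw [hL]; simp
    have hvred : IsReduced (a :: v) := reduced_part ((i0, true) :: u) _ [] (by simpa [hL] using hred)
    have hvred' : IsReduced v := reduced_part ((i0, true) :: u ++ [a]) _ [] (by simpa [hL] using hred)
    have hnv : (mk v : FreeGroup (Fin r)).norm ≤ v.length := norm_mk_le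
    rw [mk_cons, _root_.map_mul, Equiv.Perm.mul_apply, ih']
    obtain ⟨j, b⟩ := a
    cases b
    · -- negative letter
      have e : (mk [(j, false)] : FreeGroup (Fin r)) = (of j)⁻¹ := rfl
      rw [e, _root_.map_inv, Phi_of, genPerm_inv_apply]
      have hz : linc i0 T j ((QuotientGroup.mk' N (of j))⁻¹ * ((mk v : FreeGroup (Fin r)) *
          ((of i0 : FreeGroup (Fin r)) * t))) = 0 := by
        rw [linc, if_neg]
        rintro ⟨rfl, hmem⟩
        have hsep := hT t ht _ hmem ⟨(of j)⁻¹ * (mk v * of j), by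
          have h1 := norm_mul_le (of j)⁻¹ (mk v * of j)
          have h2 := norm_mul_le (mk v) (of j)
          rw [norm_inv_eq] at h1
          simp only [norm_of] at h1 h2
          omega, by simp [mul_assoc]⟩
        have hvN : mk v ∈ N := by
          have h1 : (((of j)⁻¹ * (mk v * of j) : FreeGroup (Fin r)) : FreeGroup (Fin r) ⧸ N) = 1 := by
            simp only [QuotientGroup.mk'_apply, ← mul_assoc] at hsep
            have := mul_eq_right.1 hsep
            simpa [mul_assoc] using this
          rw [QuotientGroup.eq_one_iff] at h1
          have := Subgroup.Normal.conj_mem inferInstance _ h1 (of j)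
          simpa [mul_assoc] using this
        have hv1 := hmin _ hvN (by omega)
        have hvnil : v = [] := by
          have := congrArg toWord hv1
          rwa [toWord_mk, toWord_one, hvred'.reduce_eq] at this
        subst hvnil
        have e3 : (mk ((j, true) :: L) : FreeGroup (Fin r)) = of j * mk u * (of j)⁻¹ := by
          rw [hL]; simp [FreeGroup.of, mul_mk, inv_mk, invRev]
        rw [e3] at hN
        have huN : mk u ∈ N := by
          have := Subgroup.Normal.conj_mem inferInstance _ hN (of j)⁻¹
          simpa [mul_assoc] using this
        have hu1 := hmin _ huN (by
          have : (mk u : FreeGroup (Fin r)).norm ≤ u.length := norm_mk_le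
          have h5 : L.length = u.length + 1 := by rw [hL]; simp
          omega)
        have hured : IsReduced u := reduced_part [(j, true)] _ [(j, false)] (by simpa [hL] using hred)
        have hunil : u = [] := by
          have := congrArg toWord hu1
          rwa [toWord_mk, toWord_one, hured.reduce_eq] at this
        subst hunil
        rw [hL] at hred
        simp [FreeGroup.IsReduced] at hred
      simp only [QuotientGroup.mk'_apply] at hz
      simp only [QuotientGroup.mk'_apply, hz, sub_zero]
      simp [mul_assoc]
    · have e : (mk [(j, true)] : FreeGroup (Fin r)) = of j := rfl
      rw [e, Phi_of, genPerm_apply]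
      have hz : linc i0 T j ((mk v : FreeGroup (Fin r)) *
          ((of i0 : FreeGroup (Fin r)) * t)) = 0 := by
        rw [linc, if_neg]
        rintro ⟨rfl, hmem⟩
        have hsep := hT t ht _ hmem ⟨mk v * of j, by
          have h2 := norm_mul_le (mk v) (of j)
          simp only [norm_of] at h2
          omega, by simp [mul_assoc]⟩
        have hvN : mk v * of j ∈ N := by
          rw [← QuotientGroup.eq_one_iff]
          rw [← mul_assoc] at hsep
          have := mul_eq_right.1 hsep
          simpa using this
        have hv1 := hmin _ hvN (by
          have h2 := norm_mul_le (mk v) (of j)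
          simp only [norm_of] at h2
          omega)
        have hveq : v = [(j, false)] := by
          have := congrArg toWord (mul_eq_one_iff_eq_inv.1 hv1)
          rw [toWord_mk, hvred'.reduce_eq] at this
          rw [this]; simp [invRev]
        subst hveq
        simp [FreeGroup.IsReduced] at hvred
      rw [hz, add_zero]
      simp [mul_assoc]

end bypass

section data
variable {r : ℕ}

lemma lamp_data (hr : 2 ≤ r) (N : Subgroup (FreeGroup (Fin r))) [N.Normal]
    (hnil : Group.IsNilpotent (FreeGroup (Fin r) ⧸ N)) :
    ∃ (i0 : Fin r) (T : Set (FreeGroup (Fin r) ⧸ N))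
      (τ : FreeGroup (Fin r) ⧸ N → FreeGroup (Fin r) ⧸ N) (w : ℕ),
      (∀ t, ∀ Z : Finset (FreeGroup (Fin r) ⧸ N), (∀ z ∈ Z, τ z = t) → Z.card ≤ w) ∧
      (∀ g, bHom g ∈ Ctrl (genPerm (QuotientGroup.mk' N) i0 T)) ∧
      lamp τ ∈ Ctrl (genPerm (QuotientGroup.mk' N) i0 T) := by
  classical
  obtain ⟨i0, L, hred, hN, hmin⟩ := exists_min_relator N (N_ne_bot r hr N hnil)
  obtain ⟨T, hT, hcov⟩ := exists_net N (shortSet N (L.length + 2)) (shortSet_one N _)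
    (shortSet_inv N _)
  choose τ hτ1 hτ2 using hcov
  have hfin := shortSet_finite N (L.length + 2)
  set σ := genPerm (QuotientGroup.mk' N) i0 T with hσ
  set Φ := Phi (QuotientGroup.mk' N) i0 T with hΦ
  have hΦC : ∀ w, Φ w ∈ Ctrl σ := by
    intro w
    have h1 : Φ.range ≤ Ctrl σ := by
      apply FreeGroup.range_lift_le
      rintro _ ⟨j, rfl⟩
      exact gen_mem_Ctrl σ j
    exact h1 ⟨w, rfl⟩
  have hrel : ((FreeGroup.mk L : FreeGroup (Fin r)) : FreeGroup (Fin r) ⧸ N) =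
      ((FreeGroup.of i0 : FreeGroup (Fin r)) : FreeGroup (Fin r) ⧸ N)⁻¹ := by
    rw [mk_cons, ← QuotientGroup.eq_one_iff] at hN
    rw [eq_inv_iff_mul_eq_one]
    have : ((FreeGroup.of i0 : FreeGroup (Fin r)) : FreeGroup (Fin r) ⧸ N) *
      ((FreeGroup.mk L : FreeGroup (Fin r)) : FreeGroup (Fin r) ⧸ N) = 1 := hN
    exact mul_eq_one_comm.1 this
  have hby : ∀ t ∈ T, ∀ ψ, Φ (FreeGroup.mk L) (ψ, (FreeGroup.of i0 : FreeGroup (Fin r)) * t) = (ψ, t) := by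
    intro t ht ψ
    have := bypass N i0 L hred hN hmin T hT t ht ψ [] L rfl
    rw [hΦ, this, hrel]
    simp
  have hbgen : ∀ j : Fin r, bHom ((FreeGroup.of j : FreeGroup (Fin r)) : FreeGroup (Fin r) ⧸ N) ∈ Ctrl σ := by
    intro j
    refine piecewise_mem_Ctrl σ _ {FreeGroup.of j, (FreeGroup.mk L)⁻¹} (fun w => Φ w)
      (fun i _ => hΦC i) ?_
    intro x
    by_cases h : j = i0 ∧ x.2 ∈ T
    · refine ⟨(FreeGroup.mk L)⁻¹, by simp, ?_⟩
      rw [map_inv, Equiv.Perm.eq_inv_iff_eq]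
      obtain ⟨rfl, ht⟩ := h
      exact hby x.2 ht x.1
    · refine ⟨FreeGroup.of j, by simp, ?_⟩
      rw [hΦ, Phi_of, genPerm_apply, linc, if_neg h, add_zero]
      rfl
  have hb : ∀ g, bHom g ∈ Ctrl σ := by
    intro g
    obtain ⟨w, rfl⟩ := QuotientGroup.mk_surjective g
    induction w using FreeGroup.induction_on with
    | C1 => rw [QuotientGroup.mk_one, map_one]; exact one_mem _
    | of j => exact hbgen j
    | inv_of j ih => rw [QuotientGroup.mk_inv, map_inv]; exact inv_mem ih
    | mul a b ha hb => rw [QuotientGroup.mk_mul, map_mul]; exact mul_mem ha hb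
  refine ⟨i0, T, τ, hfin.toFinset.card, ?_, hb, ?_⟩
  · intro t Z hZ
    refine Finset.card_le_card_of_injOn (fun z => z * t⁻¹) ?_ ?_
    · intro z hz
      have := hτ2 z
      rw [hZ z hz] at this
      simpa using this
    · intro z _ z' _ h
      simpa using h
  · refine piecewise_mem_Ctrl σ _ hfin.toFinset
      (fun v => bHom v * Φ (FreeGroup.mk L * FreeGroup.of i0) * bHom v⁻¹)
      (fun v _ => mul_mem (mul_mem (hb _) (hΦC _)) (hb _)) ?_
    intro x
    refine ⟨x.2 * (τ x.2)⁻¹, by simpa using hτ2 x.2, ?_⟩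
    have e : (x.2 * (τ x.2)⁻¹)⁻¹ * x.2 = τ x.2 := by group
    have e1 : bHom (x.2 * (τ x.2)⁻¹)⁻¹ x = (x.1, τ x.2) := by rw [bHom_apply, e]
    have e2 : Φ (FreeGroup.mk L * FreeGroup.of i0) (x.1, τ x.2) =
        (x.1 + linc i0 T i0 (τ x.2), τ x.2) := by
      rw [map_mul, Equiv.Perm.mul_apply]
      have e3 : Φ (FreeGroup.of i0) = genPerm (QuotientGroup.mk' N) i0 T i0 := Phi_of _ _ _ _
      rw [e3, genPerm_apply]
      exact hby _ (hτ1 _) _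
    rw [Equiv.Perm.mul_apply, Equiv.Perm.mul_apply, e1, e2, bHom_apply, lamp_apply]
    simp [linc, hτ1]

end data

section convwalk
variable {r : ℕ}

/-- support points of the lazy walk -/
def spt : Option (Fin r × Bool) → FreeGroup (Fin r)
  | none => 1
  | some (j, true) => FreeGroup.of j
  | some (j, false) => (FreeGroup.of j)⁻¹

/-- weights of the lazy walk -/
def swt : Option (Fin r × Bool) → ℝ
  | none => 1 / 2
  | some _ => 1 / (4 * r)

lemma spt_inj : Function.Injective (spt (r := r)) := by
  intro a b h
  have h' := congrArg FreeGroup.toWord h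
  rcases a with _ | ⟨j, _ | _⟩ <;> rcases b with _ | ⟨k, _ | _⟩ <;>
    simp only [spt, FreeGroup.toWord_inv, FreeGroup.toWord_of, FreeGroup.toWord_one,
      FreeGroup.invRev] at h' <;> first | rfl | (simp at h'; done) | (simp at h'; rw [h'])

open Classical in
lemma lazySRW_eq (g : FreeGroup (Fin r)) :
    lazySRW r g = ∑ a : Option (Fin r × Bool), if spt a = g then swt a else 0 := by
  by_cases hg : ∃ a, spt a = g
  · obtain ⟨a, rfl⟩ := hg
    have : ∀ b, (spt b = spt a) = (b = a) := fun b => by rw [spt_inj.eq_iff]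
    simp only [this, Finset.sum_ite_eq', Finset.mem_univ, if_true]
    rcases a with _ | ⟨j, b⟩
    · simp [lazySRW, spt, swt]
    · have h1 : spt (some (j, b)) ≠ (1 : FreeGroup (Fin r)) := by
        intro h
        have := spt_inj (show spt (some (j, b)) = spt none from h)
        simp at this
      rw [lazySRW, if_neg h1, if_pos]
      · rfl
      · refine ⟨j, ?_⟩
        cases b
        · right; rfl
        · left; rfl
  · rw [Finset.sum_eq_zero]
    · rw [lazySRW, if_neg, if_neg]
      · rintro ⟨i, h | h⟩
        · exact hg ⟨some (i, true), h.symm⟩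
        · exact hg ⟨some (i, false), h.symm⟩
      · intro h
        exact hg ⟨none, h.symm⟩
    · intro a _
      rw [if_neg]
      exact fun h => hg ⟨a, h⟩

open Classical in
lemma lazySRWQuot_eq (M : Subgroup (FreeGroup (Fin r))) [M.Normal] (h : FreeGroup (Fin r) ⧸ M) :
    lazySRWQuot r M h = ∑ a : Option (Fin r × Bool),
      if ((spt a : FreeGroup (Fin r)) : FreeGroup (Fin r) ⧸ M) = h then swt a else 0 := by
  unfold lazySRWQuot pushforward
  simp only [lazySRW_eq]
  rw [Summable.tsum_finsetSum]
  · refine Finset.sum_congr rfl fun a _ => ?_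
    split_ifs with hh
    · rw [tsum_eq_single (⟨spt a, hh⟩ : {g : FreeGroup (Fin r) // (g : FreeGroup (Fin r) ⧸ M) = h})]
      · simp
      · intro b hb
        rw [if_neg]
        intro h2
        exact hb (Subtype.ext h2.symm)
    · convert tsum_zero using 1
      congr 1
      funext b
      rw [if_neg]
      intro h2
      exact hh (h2 ▸ b.2)
  · intro a _
    apply summable_of_hasFiniteSupport
    by_cases hh : ((spt a : FreeGroup (Fin r)) : FreeGroup (Fin r) ⧸ M) = h
    · refine (Set.finite_singleton (⟨spt a, hh⟩ : {g : FreeGroup (Fin r) // (g : FreeGroup (Fin r) ⧸ M) = h})).subset ?_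
      intro b hb
      by_contra hne
      apply hb
      simp only
      rw [if_neg]
      intro h2
      exact hne (Subtype.ext h2.symm)
    · refine Set.finite_empty.subset ?_
      intro b hb
      apply hb
      simp only
      rw [if_neg]
      intro h2
      exact hh (h2 ▸ b.2)

/-- left translations by the generators -/
def lmul (M : Subgroup (FreeGroup (Fin r))) [M.Normal] (j : Fin r) : Equiv.Perm (FreeGroup (Fin r) ⧸ M) :=
  Equiv.mulLeft ((FreeGroup.of j : FreeGroup (Fin r)) : FreeGroup (Fin r) ⧸ M)

lemma conv_eq_Pop (M : Subgroup (FreeGroup (Fin r))) [M.Normal] (f : FreeGroup (Fin r) ⧸ M → ℝ) :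
    conv (lazySRWQuot r M) f = Pop (lmul M) f := by
  classical
  funext γ
  unfold conv
  have h1 : ∀ h, lazySRWQuot r M h * f (h⁻¹ * γ) = ∑ a : Option (Fin r × Bool),
      if ((spt a : FreeGroup (Fin r)) : FreeGroup (Fin r) ⧸ M) = h then swt a * f (h⁻¹ * γ) else 0 := by
    intro h
    rw [lazySRWQuot_eq, Finset.sum_mul]
    refine Finset.sum_congr rfl fun a _ => ?_
    rw [ite_mul, zero_mul]
  simp only [h1]
  rw [Summable.tsum_finsetSum]
  · have h2 : ∀ a : Option (Fin r × Bool), (∑' h, if ((spt a : FreeGroup (Fin r)) : FreeGroup (Fin r) ⧸ M) = h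
        then swt a * f (h⁻¹ * γ) else 0) =
        swt a * f (((spt a : FreeGroup (Fin r)) : FreeGroup (Fin r) ⧸ M)⁻¹ * γ) := by
      intro a
      rw [tsum_eq_single ((spt a : FreeGroup (Fin r)) : FreeGroup (Fin r) ⧸ M)]
      · simp
      · intro b hb
        rw [if_neg (Ne.symm hb)]
    simp only [h2]
    rw [Fintype.sum_option, Fintype.sum_prod_type]
    simp only [Fintype.sum_bool, spt, swt, Pop, lmul]
    rw [Finset.mul_sum]
    congr 1
    · simp; ring
    · refine Finset.sum_congr rfl fun j _ => ?_
      simp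
      ring
  · intro a _
    apply summable_of_hasFiniteSupport
    refine (Set.finite_singleton ((spt a : FreeGroup (Fin r)) : FreeGroup (Fin r) ⧸ M)).subset ?_
    intro b hb
    by_contra hne
    apply hb
    simp only
    rw [if_neg]
    exact fun h => hne h.symm

lemma convPow_eq_walk (M : Subgroup (FreeGroup (Fin r))) [M.Normal] (n : ℕ) :
    convPow (lazySRWQuot r M) n = walk (lmul M) 1 n := by
  induction n with
  | zero => funext g; simp [convPow, walk]
  | succ n ih => rw [convPow, ih, conv_eq_Pop, walk]

/-- comparison: pushing the walk forward along an orbit map does not decrease return probability. -/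
lemma walk_compare (M : Subgroup (FreeGroup (Fin r))) [M.Normal] {X : Type*}
    (σ : Fin r → Equiv.Perm X) (hM : M ≤ (FreeGroup.lift σ).ker) (x0 : X) (n : ℕ) :
    ∀ v : FreeGroup (Fin r), walk (lmul M) 1 n (v : FreeGroup (Fin r) ⧸ M) ≤
      walk σ x0 n (FreeGroup.lift σ v x0) := by
  induction n with
  | zero =>
    intro v
    simp only [walk]
    split_ifs with h1 h2
    · exact le_rfl
    · exfalso
      apply h2
      rw [QuotientGroup.eq_one_iff] at h1
      have : FreeGroup.lift σ v = 1 := hM h1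
      rw [this]; rfl
    · exact zero_le_one
    · exact le_rfl
  | succ n ih =>
    intro v
    simp only [walk, Pop]
    have h1 := ih v
    have h2 : ∀ j, walk (lmul M) 1 n (lmul M j (v : FreeGroup (Fin r) ⧸ M)) +
        walk (lmul M) 1 n ((lmul M j).symm (v : FreeGroup (Fin r) ⧸ M)) ≤
        walk σ x0 n (σ j (FreeGroup.lift σ v x0)) + walk σ x0 n ((σ j).symm (FreeGroup.lift σ v x0)) := by
      intro j
      refine add_le_add ?_ ?_
      · have := ih (FreeGroup.of j * v)
        rw [map_mul, FreeGroup.lift_apply_of] at this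
        exact this
      · have := ih ((FreeGroup.of j)⁻¹ * v)
        rw [map_mul, map_inv, FreeGroup.lift_apply_of] at this
        exact this
    have h3 := Finset.sum_le_sum fun j (_ : j ∈ Finset.univ) => h2 j
    gcongr

end convwalk

lemma growth_finset {G : Type*} [Group G] {D : ℕ} (h : HasPolyGrowth G D) :
    ∃ S : Finset G, (1 : G) ∈ S ∧ (∀ x ∈ S, x⁻¹ ∈ S) ∧ Subgroup.closure (S : Set G) = ⊤ ∧
      ∃ c C : ℝ, 0 < c ∧ c ≤ C ∧ ∀ n : ℕ, 1 ≤ n →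
      c * (n : ℝ) ^ D ≤ ((ballF S n).card : ℝ) ∧ ((ballF S n).card : ℝ) ≤ C * (n : ℝ) ^ D := by
  obtain ⟨S, hfin, h1, hinv, hcl, c, C, hc, hcC, hg⟩ := h
  refine ⟨hfin.toFinset, by simpa using h1, by simpa using hinv, by simpa using hcl, c, C, hc, hcC, ?_⟩
  intro n hn
  have h2 : Nat.card ↥(S ^ n) = (ballF hfin.toFinset n).card := by
    rw [Nat.card_coe_set_eq, ← Set.ncard_coe_finset, ballF_coe, Set.Finite.coe_toFinset]
  have h3 := hg n hn
  rw [h2] at h3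
  exact h3

lemma upper_abs (r : ℕ) (hr : 2 ≤ r)
    (N : Subgroup (FreeGroup (Fin r))) [N.Normal] (D : ℕ)
    (hnilp : Group.IsNilpotent (FreeGroup (Fin r) ⧸ N))
    (hgrowth : HasPolyGrowth (FreeGroup (Fin r) ⧸ N) D) :
    ∃ κ0 δ : ℝ, 0 < κ0 ∧ 0 < δ ∧ ∀ n M K : ℕ, 1 ≤ M → (K : ℝ) ≤ δ * (M : ℝ) ^ D →
      convPow (lazySRWQuot r ⁅N, N⁆) (2 * n) 1 ≤
        max (4 / (M : ℝ) ^ K) (Real.exp (-(κ0 * n / (M : ℝ) ^ 2))) := by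
  classical
  obtain ⟨S, hS1, -, -, c, C, hc, -, hg⟩ := growth_finset hgrowth
  obtain ⟨i0, T, τ, w, hτ, hb, hl⟩ := lamp_data hr N hnilp
  set σ := genPerm (QuotientGroup.mk' N) i0 T with hσ
  choose Cb hCb using fun g => (mem_Ctrl_iff σ _).1 (hb g)
  obtain ⟨Cl, hCl⟩ := hl
  set C4 : ℕ := Cl + ∑ s ∈ S, Cb s + 1 with hC4
  have hb' : ∀ s ∈ S, ∀ U, dU U (bHom s) ≤ C4 * bd σ U := by
    intro s hs U
    refine (hCb s U).trans (Nat.mul_le_mul_right _ ?_)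
    have := Finset.single_le_sum (f := Cb) (fun _ _ => Nat.zero_le _) hs
    omega
  have hl' : ∀ U, dU U (lamp τ) ≤ C4 * bd σ U := fun U =>
    (hCl U).trans (Nat.mul_le_mul_right _ (by omega))
  have hC4pos : (0 : ℝ) < C4 := by exact_mod_cast (by omega : 0 < C4)
  have hrpos : (0 : ℝ) < r := by exact_mod_cast (by omega : 0 < r)
  refine ⟨1 / ((96 * C4) ^ 2 * (32 * r ^ 2)), c / (8 * (w + 1)), by positivity, by positivity, ?_⟩
  intro n M K hM hK
  have hMpos : (0 : ℝ) < M := by exact_mod_cast hM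
  rw [convPow_eq_walk]
  have hcmp := walk_compare ⁅N, N⁆ σ (Phi_comm (QuotientGroup.mk' N) i0 T N (by simp)) (0, 1) (2 * n) 1
  rw [map_one, QuotientGroup.mk_one] at hcmp
  refine hcmp.trans ?_
  have hdec := walk_decay σ (by omega) (1 / (96 * C4 * M)) (by positivity) ((M : ℝ) ^ K) (by positivity)
    (by
      intro U hU
      by_contra hlt
      push Not at hlt
      have h1 : 96 * C4 * M * bd σ U < U.card := by
        rw [div_mul_eq_mul_div, one_mul, lt_div_iff₀ (by positivity)] at hlt
        have h2 : ((96 * C4 * M * bd σ U : ℕ) : ℝ) < U.card := by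
          push_cast; linarith
        exact_mod_cast h2
      have hKc : 8 * w * K ≤ (ballF S (4 * M)).card := by
        have h3 := (hg (4 * M) (by omega)).1
        have h4 : (K : ℝ) * (8 * (w + 1)) ≤ c * (M : ℝ) ^ D := by
          rw [div_mul_eq_mul_div, le_div_iff₀ (by positivity)] at hK
          exact hK
        have h5 : c * (M : ℝ) ^ D ≤ c * ((4 * M : ℕ) : ℝ) ^ D := by
          gcongr
          push_cast; linarith
        have h6 : ((8 * w * K : ℕ) : ℝ) ≤ ((ballF S (4 * M)).card : ℝ) := by
          push_cast
          have : (0 : ℝ) ≤ K := Nat.cast_nonneg _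
          nlinarith
        exact_mod_cast h6
      have h7 := faber_krahn S τ w hτ hS1 σ C4 hb' hl' M K hM hKc U h1
      have h8 : ((M : ℝ) ^ K) ≤ U.card := by exact_mod_cast h7
      linarith) (0, 1) n
  refine hdec.trans (le_of_eq ?_)
  congr 2
  field_simp

section killed
variable {X : Type*} {r : ℕ}

lemma cs_tsum {f g : X → ℝ} (hf : HasFiniteSupport f) (hg : HasFiniteSupport g) :
    (∑' x, f x * g x) ^ 2 ≤ (∑' x, f x ^ 2) * ∑' x, g x ^ 2 := by
  classical
  set s := hf.toFinset ∪ hg.toFinset with hs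
  have hf0 : ∀ x, x ∉ s → f x = 0 := by
    intro x hx
    by_contra h
    exact hx (Finset.mem_union_left _ ((mem_fs hf x).2 h))
  have hg0 : ∀ x, x ∉ s → g x = 0 := by
    intro x hx
    by_contra h
    exact hx (Finset.mem_union_right _ ((mem_fs hg x).2 h))
  rw [tsum_eq_sum (s := s) (fun x hx => by rw [hf0 x hx, zero_mul]),
    tsum_eq_sum (s := s) (fun x hx => by rw [hf0 x hx]; norm_num),
    tsum_eq_sum (s := s) (fun x hx => by rw [hg0 x hx]; norm_num)]
  exact Finset.sum_mul_sq_le_sq_mul_sq _ _ _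

open Classical in
/-- killed Markov operator -/
def Kop (σ : Fin r → Equiv.Perm X) (B : Set X) (f : X → ℝ) : X → ℝ := fun x =>
  if x ∈ B then Pop σ f x else 0

lemma Kop_of_mem (σ : Fin r → Equiv.Perm X) {B : Set X} (f : X → ℝ) {x : X} (hx : x ∈ B) :
    Kop σ B f x = Pop σ f x := by simp [Kop, hx]

lemma Kop_of_not_mem (σ : Fin r → Equiv.Perm X) {B : Set X} (f : X → ℝ) {x : X} (hx : x ∉ B) :
    Kop σ B f x = 0 := by simp [Kop, hx]

lemma Kop_nonneg (σ : Fin r → Equiv.Perm X) (B : Set X) {f : X → ℝ} (hf : ∀ x, 0 ≤ f x) (x : X) :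
    0 ≤ Kop σ B f x := by
  by_cases hx : x ∈ B
  · rw [Kop_of_mem σ f hx]; exact Pop_nonneg σ hf x
  · rw [Kop_of_not_mem σ f hx]

lemma Kop_mono (σ : Fin r → Equiv.Perm X) (B : Set X) {f g : X → ℝ} (hf : ∀ x, f x ≤ g x) (x : X) :
    Kop σ B f x ≤ Kop σ B g x := by
  by_cases hx : x ∈ B
  · rw [Kop_of_mem σ f hx, Kop_of_mem σ g hx]; exact Pop_mono σ hf x
  · rw [Kop_of_not_mem σ f hx, Kop_of_not_mem σ g hx]

lemma Kop_le_Pop (σ : Fin r → Equiv.Perm X) (B : Set X) {f : X → ℝ} (hf : ∀ x, 0 ≤ f x) (x : X) :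
    Kop σ B f x ≤ Pop σ f x := by
  by_cases hx : x ∈ B
  · rw [Kop_of_mem σ f hx]
  · rw [Kop_of_not_mem σ f hx]; exact Pop_nonneg σ hf x

lemma Kop_fs (σ : Fin r → Equiv.Perm X) (B : Set X) {f : X → ℝ} (hf : HasFiniteSupport f) :
    HasFiniteSupport (Kop σ B f) := by
  refine fs_of_imp (Pop_fs σ hf) fun x hx => ?_
  by_cases hxB : x ∈ B
  · rw [Kop_of_mem σ f hxB, hx]
  · rw [Kop_of_not_mem σ f hxB]

lemma Kop_adj (σ : Fin r → Equiv.Perm X) (B : Set X) {f g : X → ℝ} (hf : HasFiniteSupport f)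
    (hfB : ∀ x, x ∉ B → f x = 0) (hgB : ∀ x, x ∉ B → g x = 0) :
    ∑' x, Kop σ B f x * g x = ∑' x, f x * Kop σ B g x := by
  have h1 : ∀ x, Kop σ B f x * g x = Pop σ f x * g x := by
    intro x
    by_cases hx : x ∈ B
    · rw [Kop_of_mem σ f hx]
    · rw [hgB x hx, mul_zero, mul_zero]
  have h2 : ∀ x, f x * Kop σ B g x = f x * Pop σ g x := by
    intro x
    by_cases hx : x ∈ B
    · rw [Kop_of_mem σ g hx]
    · rw [hfB x hx, zero_mul, zero_mul]
  simp only [h1, h2]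
  exact Pop_self_adj_left σ hf

/-- iterates of the killed operator -/
def kit (σ : Fin r → Equiv.Perm X) (B : Set X) (f : X → ℝ) : ℕ → X → ℝ
  | 0 => f
  | n + 1 => Kop σ B (kit σ B f n)

lemma kit_fs (σ : Fin r → Equiv.Perm X) (B : Set X) {f : X → ℝ} (hf : HasFiniteSupport f) (n : ℕ) :
    HasFiniteSupport (kit σ B f n) := by
  induction n with
  | zero => exact hf
  | succ n ih => exact Kop_fs σ B ih

lemma kit_nonneg (σ : Fin r → Equiv.Perm X) (B : Set X) {f : X → ℝ} (hf : ∀ x, 0 ≤ f x) (n : ℕ) :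
    ∀ x, 0 ≤ kit σ B f n x := by
  induction n with
  | zero => exact hf
  | succ n ih => exact Kop_nonneg σ B ih

lemma kit_off (σ : Fin r → Equiv.Perm X) (B : Set X) {f : X → ℝ} (hf : ∀ x, x ∉ B → f x = 0) (n : ℕ) :
    ∀ x, x ∉ B → kit σ B f n x = 0 := by
  cases n with
  | zero => exact hf
  | succ n => exact fun x hx => Kop_of_not_mem σ _ hx

lemma kit_mono (σ : Fin r → Equiv.Perm X) (B : Set X) {f g : X → ℝ} (h : ∀ x, f x ≤ g x) (n : ℕ) :
    ∀ x, kit σ B f n x ≤ kit σ B g n x := by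
  induction n with
  | zero => exact h
  | succ n ih => exact Kop_mono σ B ih

lemma kit_smul (σ : Fin r → Equiv.Perm X) (B : Set X) (f : X → ℝ) (c : ℝ) (n : ℕ) :
    kit σ B (fun x => c * f x) n = fun x => c * kit σ B f n x := by
  induction n with
  | zero => rfl
  | succ n ih =>
    funext x
    simp only [kit, ih]
    by_cases hx : x ∈ B
    · rw [Kop_of_mem σ _ hx, Kop_of_mem σ _ hx]
      simp only [Pop, ← mul_add, ← Finset.mul_sum]
      ring
    · rw [Kop_of_not_mem σ _ hx, Kop_of_not_mem σ _ hx, mul_zero]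

lemma kit_pair (σ : Fin r → Equiv.Perm X) (B : Set X) {f : X → ℝ} (hf : HasFiniteSupport f)
    (hfB : ∀ x, x ∉ B → f x = 0) (n m : ℕ) :
    ∑' x, kit σ B f n x * kit σ B f m x = ∑' x, kit σ B f (n + m) x * f x := by
  induction m generalizing n with
  | zero => rfl
  | succ m ih =>
    rw [show n + (m + 1) = (n + 1) + m by ring, ← ih (n + 1)]
    exact (Kop_adj σ B (kit_fs σ B hf n) (kit_off σ B hfB n) (kit_off σ B hfB m)).symm

lemma kit_spectral (σ : Fin r → Equiv.Perm X) (B : Set X) {f : X → ℝ} (hf : HasFiniteSupport f)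
    (hfB : ∀ x, x ∉ B → f x = 0) (β : ℝ) (hβ : 0 < β) (hpos : 0 < ∑' x, f x ^ 2)
    (h1 : β * ∑' x, f x ^ 2 ≤ ∑' x, f x * Pop σ f x) (n : ℕ) :
    β ^ (2 * n) * ∑' x, f x ^ 2 ≤ ∑' x, kit σ B f (2 * n) x * f x := by
  set b : ℕ → ℝ := fun k => ∑' x, kit σ B f k x ^ 2 with hb
  have hb0 : b 0 = ∑' x, f x ^ 2 := rfl
  have hlc : ∀ k, b (k + 1) ^ 2 ≤ b k * b (k + 2) := by
    intro k
    have h2 : b (k + 1) = ∑' x, kit σ B f k x * kit σ B f (k + 2) x := by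
      simp only [hb, sq]
      rw [kit_pair σ B hf hfB, kit_pair σ B hf hfB]
      congr 1
      funext x
      rw [show k + 1 + (k + 1) = k + (k + 2) by ring]
    rw [h2]
    exact cs_tsum (kit_fs σ B hf _) (kit_fs σ B hf _)
  have hb1 : β ^ 2 * b 0 ≤ b 1 := by
    have h3 : ∑' x, f x * Pop σ f x = ∑' x, f x * kit σ B f 1 x := by
      congr 1
      funext x
      by_cases hx : x ∈ B
      · simp only [kit]; rw [Kop_of_mem σ _ hx]
      · rw [hfB x hx, zero_mul, zero_mul]
    have h4 := cs_tsum hf (kit_fs σ B hf 1)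
    rw [← h3] at h4
    have h5 : (β * b 0) ^ 2 ≤ b 0 * b 1 := le_trans (pow_le_pow_left₀ (by positivity) h1 2) h4
    have h6 : b 0 * (β ^ 2 * b 0) ≤ b 0 * b 1 := by linarith [h5, show (β * b 0)^2 = b 0 * (β^2 * b 0) by ring]
    exact le_of_mul_le_mul_left h6 hpos
  have hind : ∀ k, 0 < b k ∧ β ^ 2 * b k ≤ b (k + 1) := by
    intro k
    induction k with
    | zero => exact ⟨hpos, hb1⟩
    | succ k ih =>
      have hp : 0 < b (k + 1) := lt_of_lt_of_le (mul_pos (by positivity) ih.1) ih.2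
      refine ⟨hp, ?_⟩
      have h7 : b k * (β ^ 2 * b (k + 1)) ≤ b k * b (k + 2) := by
        calc b k * (β ^ 2 * b (k + 1)) = (β ^ 2 * b k) * b (k + 1) := by ring
          _ ≤ b (k + 1) * b (k + 1) := by gcongr; exact ih.2
          _ = b (k + 1) ^ 2 := by ring
          _ ≤ _ := hlc k
      exact le_of_mul_le_mul_left h7 ih.1
  have hfin : ∀ k, β ^ (2 * k) * b 0 ≤ b k := by
    intro k
    induction k with
    | zero => simp
    | succ k ih =>
      calc β ^ (2 * (k + 1)) * b 0 = β ^ 2 * (β ^ (2 * k) * b 0) := by ring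
        _ ≤ β ^ 2 * b k := by gcongr
        _ ≤ _ := (hind k).2
  have h8 := hfin n
  have h9 : b n = ∑' x, kit σ B f (2 * n) x * f x := by
    simp only [hb, sq]
    rw [kit_pair σ B hf hfB, ← two_mul]
  rw [← h9]
  exact h8

open Classical in
/-- indicator -/
def ind (B : Finset X) : X → ℝ := fun x => if x ∈ B then 1 else 0

lemma ind_fs (B : Finset X) : HasFiniteSupport (ind B) := fs_ite_finset B 1
lemma ind_nonneg (B : Finset X) (x : X) : 0 ≤ ind B x := by
  unfold ind; split_ifs <;> norm_num
lemma ind_mem {B : Finset X} {x : X} (h : x ∈ B) : ind B x = 1 := if_pos h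
lemma ind_not_mem {B : Finset X} {x : X} (h : x ∉ B) : ind B x = 0 := if_neg h

/-- survival probabilities -/
def surv (σ : Fin r → Equiv.Perm X) (B : Finset X) (n : ℕ) : X → ℝ := kit σ (B : Set X) (ind B) n

lemma surv_nonneg (σ : Fin r → Equiv.Perm X) (B : Finset X) (n : ℕ) (x : X) : 0 ≤ surv σ B n x :=
  kit_nonneg σ _ (ind_nonneg B) n x

lemma surv_succ_le (hr : 0 < r) (σ : Fin r → Equiv.Perm X) (B : Finset X) (n : ℕ) :
    ∀ x, surv σ B (n + 1) x ≤ surv σ B n x := by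
  have hr' : (r : ℝ) ≠ 0 := by exact_mod_cast hr.ne'
  induction n with
  | zero =>
    intro x
    by_cases hx : x ∈ B
    · show Kop σ B (ind B) x ≤ ind B x
      rw [Kop_of_mem σ _ (by exact_mod_cast hx), ind_mem hx]
      have h1 : ∀ y, ind B y ≤ (fun _ => (1:ℝ)) y := by
        intro y; unfold ind; split_ifs <;> norm_num
      refine (Pop_mono σ h1 x).trans ?_
      simp only [Pop, Finset.sum_const, Finset.card_univ, Fintype.card_fin, nsmul_eq_mul]
      field_simp
      norm_num
    · show Kop σ B (ind B) x ≤ ind B x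
      rw [Kop_of_not_mem σ _ (by exact_mod_cast hx)]
      exact ind_nonneg B x
  | succ n ih => exact Kop_mono σ _ ih

lemma surv_anti (hr : 0 < r) (σ : Fin r → Equiv.Perm X) (B : Finset X) (x : X) :
    Antitone fun n => surv σ B n x :=
  antitone_nat_of_succ_le fun n => surv_succ_le hr σ B n x

lemma surv_max (σ : Fin r → Equiv.Perm X) (B : Finset X) {h : X → ℝ} (hf : HasFiniteSupport h)
    (h0 : ∀ x, 0 ≤ h x)
    (hfB : ∀ x, x ∉ B → h x = 0) (H : ℝ) (hH : ∀ x, h x ≤ H) (hHpos : 0 < H) (β : ℝ) (hβ : 0 < β)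
    (hpos : 0 < ∑' x, h x ^ 2)
    (h1 : β * ∑' x, h x ^ 2 ≤ ∑' x, h x * Pop σ h x) (n : ℕ) :
    ∃ x ∈ B, β ^ (2 * n) * ∑' x, h x ^ 2 ≤ H ^ 2 * B.card * surv σ B (2 * n) x := by
  have hfB' : ∀ x, x ∉ (B : Set X) → h x = 0 := fun x hx => hfB x (by exact_mod_cast hx)
  have key := kit_spectral σ (B : Set X) hf hfB' β hβ hpos h1 n
  have hle : ∀ x, h x ≤ H * ind B x := by
    intro x
    by_cases hx : x ∈ B
    · rw [ind_mem hx, mul_one]; exact hH x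
    · rw [ind_not_mem hx, mul_zero, hfB x hx]
  have hk : ∀ x, kit σ (B : Set X) h (2 * n) x ≤ H * surv σ B (2 * n) x := by
    intro x
    have := kit_mono σ (B : Set X) hle (2 * n) x
    rwa [kit_smul] at this
  have h2 : ∑' x, kit σ (B : Set X) h (2 * n) x * h x ≤ ∑ x ∈ B, H ^ 2 * surv σ B (2 * n) x := by
    rw [tsum_eq_sum (s := B) (fun x hx => by rw [hfB x hx, mul_zero])]
    refine Finset.sum_le_sum fun x _ => ?_
    calc kit σ (B : Set X) h (2 * n) x * h x ≤ (H * surv σ B (2 * n) x) * H := by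
          refine mul_le_mul (hk x) (hH x) (h0 x) (mul_nonneg hHpos.le (surv_nonneg σ B _ x))
      _ = _ := by ring
  have hBne : B.Nonempty := by
    by_contra hne
    rw [Finset.not_nonempty_iff_eq_empty] at hne
    have : ∀ x, h x ^ 2 = 0 := fun x => by rw [hfB x (by simp [hne])]; norm_num
    simp [this] at hpos
  obtain ⟨x, hx, hmax⟩ := Finset.exists_max_image B (fun x => surv σ B (2 * n) x) hBne
  refine ⟨x, hx, key.trans (h2.trans ?_)⟩
  calc ∑ y ∈ B, H ^ 2 * surv σ B (2 * n) y ≤ ∑ y ∈ B, H ^ 2 * surv σ B (2 * n) x := by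
        refine Finset.sum_le_sum fun y hy => ?_
        have := hmax y hy
        gcongr
    _ = _ := by rw [Finset.sum_const, nsmul_eq_mul]; ring

end killed

section balls
variable {G : Type*} [Group G]

lemma ballF_mul (S : Finset G) {m n : ℕ} {a b : G} (ha : a ∈ ballF S m) (hb : b ∈ ballF S n) :
    a * b ∈ ballF S (m + n) := by
  induction n generalizing b with
  | zero =>
    rw [ballF_zero, Finset.mem_singleton] at hb
    rw [hb, mul_one]; exact ha
  | succ n ih =>
    obtain ⟨c, hc, d, hd, rfl⟩ := (mem_ballF_succ S n b).1 hb
    exact (mem_ballF_succ S (m + n) _).2 ⟨a * c, ih hc, d, hd, by group⟩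

lemma ballF_mono (S : Finset G) (h1 : (1 : G) ∈ S) {m n : ℕ} (h : m ≤ n) {a : G}
    (ha : a ∈ ballF S m) : a ∈ ballF S n := by
  induction n, h using Nat.le_induction with
  | base => exact ha
  | succ n _ ih => exact (mem_ballF_succ S n a).2 ⟨a, ih, 1, h1, mul_one a⟩

lemma ballF_one (S : Finset G) (h1 : (1 : G) ∈ S) (n : ℕ) : (1 : G) ∈ ballF S n :=
  ballF_mono S h1 (Nat.zero_le n) (by rw [ballF_zero]; exact Finset.mem_singleton_self 1)

lemma ballF_of_mem (S : Finset G) {a : G} (ha : a ∈ S) : a ∈ ballF S 1 :=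
  (mem_ballF_succ S 0 a).2 ⟨1, by rw [ballF_zero]; exact Finset.mem_singleton_self 1, a, ha, one_mul a⟩

lemma ballF_inv (S : Finset G) (hinv : ∀ x ∈ S, x⁻¹ ∈ S) {n : ℕ} {a : G}
    (ha : a ∈ ballF S n) : a⁻¹ ∈ ballF S n := by
  induction n generalizing a with
  | zero =>
    rw [ballF_zero, Finset.mem_singleton] at ha ⊢
    rw [ha, inv_one]
  | succ n ih =>
    obtain ⟨c, hc, d, hd, rfl⟩ := (mem_ballF_succ S n a).1 ha
    rw [mul_inv_rev, Nat.add_comm]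
    exact ballF_mul S (ballF_of_mem S (hinv d hd)) (ih hc)

lemma ballF_exists (S : Finset G) (hinv : ∀ x ∈ S, x⁻¹ ∈ S)
    (hcl : Subgroup.closure (S : Set G) = ⊤) (g : G) : ∃ n, g ∈ ballF S n := by
  have hg : g ∈ Subgroup.closure (S : Set G) := by rw [hcl]; trivial
  induction hg using Subgroup.closure_induction with
  | mem x hx => exact ⟨1, ballF_of_mem S (by exact_mod_cast hx)⟩
  | one => exact ⟨0, by rw [ballF_zero]; exact Finset.mem_singleton_self 1⟩
  | mul x y _ _ hx hy =>
    obtain ⟨m, hm⟩ := hx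
    obtain ⟨n, hn⟩ := hy
    exact ⟨m + n, ballF_mul S hm hn⟩
  | inv x _ hx =>
    obtain ⟨m, hm⟩ := hx
    exact ⟨m, ballF_inv S hinv hm⟩

/-- tent function -/
def tent (S : Finset G) (ρ : ℕ) : G → ℝ := fun g => ∑ k ∈ Finset.range (2 * ρ), ind (ballF S k) g

lemma ind_le_one {X : Type*} (B : Finset X) (x : X) : ind B x ≤ 1 := by
  unfold ind; split_ifs <;> norm_num

lemma tent_nonneg (S : Finset G) (ρ : ℕ) (g : G) : 0 ≤ tent S ρ g :=
  Finset.sum_nonneg fun _ _ => ind_nonneg _ _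

lemma tent_le (S : Finset G) (ρ : ℕ) (g : G) : tent S ρ g ≤ 2 * ρ := by
  unfold tent
  refine (Finset.sum_le_sum fun k _ => ind_le_one (ballF S k) g).trans ?_
  simp

lemma tent_off (S : Finset G) (h1 : (1 : G) ∈ S) (ρ : ℕ) (g : G) (hg : g ∉ ballF S (2 * ρ)) :
    tent S ρ g = 0 := by
  unfold tent
  refine Finset.sum_eq_zero fun k hk => ind_not_mem fun h => hg ?_
  exact ballF_mono S h1 (Finset.mem_range.1 hk).le h

lemma tent_ge (S : Finset G) (h1 : (1 : G) ∈ S) (ρ : ℕ) (g : G) (hg : g ∈ ballF S ρ) :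
    (ρ : ℝ) ≤ tent S ρ g := by
  unfold tent
  rw [two_mul, Finset.sum_range_add]
  have h2 : ∑ x ∈ Finset.range ρ, ind (ballF S (ρ + x)) g = ρ := by
    rw [Finset.sum_congr rfl fun x _ => ind_mem (ballF_mono S h1 (Nat.le_add_right ρ x) hg)]
    simp
  rw [h2]
  have : 0 ≤ ∑ x ∈ Finset.range ρ, ind (ballF S x) g := Finset.sum_nonneg fun _ _ => ind_nonneg _ _
  linarith

lemma tent_fs (S : Finset G) (h1 : (1 : G) ∈ S) (ρ : ℕ) : HasFiniteSupport (tent S ρ) :=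
  fs_of_imp (ind_fs (ballF S (2 * ρ))) fun g hg => tent_off S h1 ρ g fun h => by
    rw [ind_mem h] at hg; norm_num at hg

lemma tent_lip (S : Finset G) (ρ C0 : ℕ) (s g : G) (hs : s ∈ ballF S C0) :
    tent S ρ g ≤ tent S ρ (s * g) + C0 := by
  unfold tent
  have h2 : ∑ k ∈ Finset.range (2 * ρ), ind (ballF S k) g ≤
      ∑ k ∈ Finset.range (2 * ρ), ind (ballF S (C0 + k)) (s * g) := by
    refine Finset.sum_le_sum fun k _ => ?_
    by_cases hg : g ∈ ballF S k
    · rw [ind_mem (ballF_mul S hs hg)]; exact ind_le_one _ _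
    · rw [ind_not_mem hg]; exact ind_nonneg _ _
  have h3 := Finset.sum_range_add (fun k => ind (ballF S k) (s * g)) C0 (2 * ρ)
  have h4 := Finset.sum_range_add (fun k => ind (ballF S k) (s * g)) (2 * ρ) C0
  rw [Nat.add_comm C0 (2 * ρ)] at h3
  have h5 : 0 ≤ ∑ k ∈ Finset.range C0, ind (ballF S k) (s * g) :=
    Finset.sum_nonneg fun _ _ => ind_nonneg _ _
  have h6 : ∑ k ∈ Finset.range C0, ind (ballF S (2 * ρ + k)) (s * g) ≤ C0 := by
    refine (Finset.sum_le_sum fun k _ => ind_le_one (ballF S (2 * ρ + k)) (s * g)).trans ?_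
    simp
  linarith

end balls

section survlow
variable {r : ℕ} (N : Subgroup (FreeGroup (Fin r))) [N.Normal]

lemma surv_translate (S : Finset (FreeGroup (Fin r) ⧸ N)) (hinv : ∀ x ∈ S, x⁻¹ ∈ S) (ρ : ℕ)
    (x : FreeGroup (Fin r) ⧸ N) (hx : x ∈ ballF S (2 * ρ)) (n : ℕ) :
    ∀ g, surv (lmul N) (ballF S (2 * ρ)) n (g * x) ≤ surv (lmul N) (ballF S (4 * ρ)) n g := by
  have hmem : ∀ g, g * x ∈ ballF S (2 * ρ) → g ∈ ballF S (4 * ρ) := by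
    intro g hg
    have := ballF_mul S hg (ballF_inv S hinv hx)
    rwa [mul_inv_cancel_right, ← two_mul, ← mul_assoc] at this
  induction n with
  | zero =>
    intro g
    show ind _ _ ≤ ind _ _
    by_cases hg : g * x ∈ ballF S (2 * ρ)
    · rw [ind_mem hg, ind_mem (hmem g hg)]
    · rw [ind_not_mem hg]; exact ind_nonneg _ _
  | succ n ih =>
    intro g
    by_cases hg : g * x ∈ ballF S (2 * ρ)
    · show Kop _ _ _ _ ≤ Kop _ _ _ _
      rw [Kop_of_mem _ _ (by exact_mod_cast hg), Kop_of_mem _ _ (by exact_mod_cast hmem g hg)]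
      have h2 : ∀ j, kit (lmul N) (ballF S (2 * ρ)) (ind (ballF S (2 * ρ))) n (lmul N j (g * x)) +
          kit (lmul N) (ballF S (2 * ρ)) (ind (ballF S (2 * ρ))) n ((lmul N j).symm (g * x)) ≤
          kit (lmul N) (ballF S (4 * ρ)) (ind (ballF S (4 * ρ))) n (lmul N j g) +
          kit (lmul N) (ballF S (4 * ρ)) (ind (ballF S (4 * ρ))) n ((lmul N j).symm g) := by
        intro j
        refine add_le_add ?_ ?_
        · have := ih (lmul N j g)
          rwa [show lmul N j g * x = lmul N j (g * x) from
            mul_assoc ((FreeGroup.of j : FreeGroup (Fin r)) : FreeGroup (Fin r) ⧸ N) g x] at this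
        · have := ih ((lmul N j).symm g)
          rwa [show (lmul N j).symm g * x = (lmul N j).symm (g * x) from
            mul_assoc (((FreeGroup.of j : FreeGroup (Fin r)) : FreeGroup (Fin r) ⧸ N)⁻¹) g x] at this
      have h3 := Finset.sum_le_sum fun j (_ : j ∈ Finset.univ) => h2 j
      have h4 := ih g
      unfold surv at h4
      unfold Pop
      gcongr
    · show Kop _ _ _ _ ≤ _
      rw [Kop_of_not_mem _ _ (by exact_mod_cast hg)]
      exact surv_nonneg _ _ _ _

lemma tent_energy (S : Finset (FreeGroup (Fin r) ⧸ N)) (h1 : 1 ∈ S) (ρ C0 : ℕ)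
    (hC0 : ∀ j, ((FreeGroup.of j : FreeGroup (Fin r)) : FreeGroup (Fin r) ⧸ N) ∈ ballF S C0)
    (hC0' : ∀ j, ((FreeGroup.of j : FreeGroup (Fin r)) : FreeGroup (Fin r) ⧸ N)⁻¹ ∈ ballF S C0) :
    Energy (lmul N) (tent S ρ) ≤ r * (2 * C0 ^ 2 * (ballF S (2 * ρ)).card) := by
  unfold Energy
  have hj : ∀ j ∈ (Finset.univ : Finset (Fin r)), ∑' x, (tent S ρ x - tent S ρ (lmul N j x)) ^ 2 ≤
      2 * C0 ^ 2 * (ballF S (2 * ρ)).card := by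
    intro j _
    set B := ballF S (2 * ρ) with hB
    have hpt : ∀ x, (tent S ρ x - tent S ρ (lmul N j x)) ^ 2 ≤
        C0 ^ 2 * (ind B x + ind B (lmul N j x)) := by
      intro x
      by_cases hx : x ∈ B ∨ lmul N j x ∈ B
      · have h2 : (1:ℝ) ≤ ind B x + ind B (lmul N j x) := by
          rcases hx with hx | hx
          · rw [ind_mem hx]; linarith [ind_nonneg B (lmul N j x)]
          · rw [ind_mem hx]; linarith [ind_nonneg B x]
        have h3 := tent_lip S ρ C0 _ x (hC0 j)
        have h4 := tent_lip S ρ C0 _ (lmul N j x) (hC0' j)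
        rw [show ((FreeGroup.of j : FreeGroup (Fin r)) : FreeGroup (Fin r) ⧸ N)⁻¹ * lmul N j x = x from
          inv_mul_cancel_left _ _] at h4
        have h3' : tent S ρ x ≤ tent S ρ (lmul N j x) + C0 := h3
        have h5 : (tent S ρ x - tent S ρ (lmul N j x)) ^ 2 ≤ (C0 : ℝ) ^ 2 := by
          apply sq_le_sq'
          · linarith
          · linarith
        calc _ ≤ (C0 : ℝ) ^ 2 * 1 := by rw [mul_one]; exact h5
          _ ≤ _ := by gcongr
      · push Not at hx
        rw [tent_off S h1 ρ x hx.1, tent_off S h1 ρ _ hx.2, ind_not_mem hx.1, ind_not_mem hx.2]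
        norm_num
    have hs1 : Summable (ind B) := fs_summable (ind_fs B)
    have hs2 : Summable fun x => ind B (lmul N j x) := fs_summable (fs_perm (ind_fs B) (lmul N j))
    have hs3 : Summable fun x => (C0:ℝ) ^ 2 * (ind B x + ind B (lmul N j x)) := (hs1.add hs2).mul_left _
    have hs0 : Summable fun x => (tent S ρ x - tent S ρ (lmul N j x)) ^ 2 :=
      Summable.of_nonneg_of_le (fun _ => sq_nonneg _) hpt hs3
    refine (hs0.tsum_le_tsum hpt hs3).trans ?_
    rw [tsum_mul_left, hs1.tsum_add hs2, tsum_perm (lmul N j) (ind B)]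
    have : ∑' x, ind B x = B.card := by
      have := tsum_ite_finset B 1
      rw [one_mul] at this
      exact this
    rw [this]
    linarith
  refine (Finset.sum_le_sum hj).trans ?_
  simp

lemma surv_lower (hr : 0 < r) (D : ℕ) (S : Finset (FreeGroup (Fin r) ⧸ N)) (h1 : 1 ∈ S)
    (hinv : ∀ x ∈ S, x⁻¹ ∈ S) (hcl : Subgroup.closure (S : Set (FreeGroup (Fin r) ⧸ N)) = ⊤)
    (c C : ℝ) (hc : 0 < c) (hcC : c ≤ C)
    (hg : ∀ n : ℕ, 1 ≤ n → c * (n : ℝ) ^ D ≤ ((ballF S n).card : ℝ) ∧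
      ((ballF S n).card : ℝ) ≤ C * (n : ℝ) ^ D) :
    ∃ a A : ℝ, 0 < a ∧ 0 < A ∧ ∃ ρ0 : ℕ, 1 ≤ ρ0 ∧ ∀ ρ n : ℕ, ρ0 ≤ ρ →
      a * Real.exp (-(A * n / (ρ : ℝ) ^ 2)) ≤ surv (lmul N) (ballF S (4 * ρ)) n 1 := by
  choose f hf using fun j : Fin r =>
    ballF_exists S hinv hcl ((FreeGroup.of j : FreeGroup (Fin r)) : FreeGroup (Fin r) ⧸ N)
  set C0 : ℕ := ∑ j, f j + 1 with hC0def
  have hC0 : ∀ j, ((FreeGroup.of j : FreeGroup (Fin r)) : FreeGroup (Fin r) ⧸ N) ∈ ballF S C0 := by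
    intro j
    refine ballF_mono S h1 ?_ (hf j)
    have := Finset.single_le_sum (f := f) (fun _ _ => Nat.zero_le _) (Finset.mem_univ j)
    omega
  have hC0' : ∀ j, ((FreeGroup.of j : FreeGroup (Fin r)) : FreeGroup (Fin r) ⧸ N)⁻¹ ∈ ballF S C0 :=
    fun j => ballF_inv S hinv (hC0 j)
  have hC0pos : (0:ℝ) < C0 := by exact_mod_cast (by omega : 0 < C0)
  have hC : 0 < C := hc.trans_le hcC
  have hrpos : (0:ℝ) < r := by exact_mod_cast hr
  set Q : ℝ := C / c * 2 ^ D with hQ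
  have hQpos : 0 < Q := by positivity
  refine ⟨1 / (4 * Q), 2 * C0 ^ 2 * Q, by positivity, by positivity, ⌈(C0:ℝ) ^ 2 * Q⌉₊ + 1, by omega, ?_⟩
  intro ρ n hρ
  have hρ1 : 1 ≤ ρ := by omega
  have hρpos : (0:ℝ) < ρ := by exact_mod_cast hρ1
  have hρ1' : (1:ℝ) ≤ ρ := by exact_mod_cast hρ1
  have hρ2 : (C0:ℝ) ^ 2 * Q ≤ ρ := by
    refine (Nat.le_ceil _).trans ?_
    exact_mod_cast (by omega : ⌈(C0:ℝ) ^ 2 * Q⌉₊ ≤ ρ)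
  have hρ3 : (C0:ℝ) ^ 2 * Q ≤ (ρ:ℝ) ^ 2 := hρ2.trans (by nlinarith)
  set B := ballF S (2 * ρ) with hB
  set b : ℝ := ((ballF S ρ).card : ℝ) with hb
  have hbpos : 0 < b := lt_of_lt_of_le (by positivity) (hg ρ hρ1).1
  have hBb : (B.card : ℝ) ≤ Q * b := by
    have h2 := (hg (2 * ρ) (by omega)).2
    have h3 := (hg ρ hρ1).1
    push_cast at h2
    calc (B.card : ℝ) ≤ C * (2 * ρ) ^ D := h2
      _ = Q * (c * ρ ^ D) := by rw [hQ, mul_pow]; field_simp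
      _ ≤ Q * b := by gcongr
  set y : ℝ := C0 ^ 2 * Q / (2 * ρ ^ 2) with hy
  have hy2 : y ≤ 1 / 2 := by
    rw [hy, div_le_div_iff₀ (by positivity) (by norm_num)]
    linarith
  have hy0 : 0 < y := by positivity
  set h := tent S ρ with hh
  have hfs : HasFiniteSupport h := tent_fs S h1 ρ
  set nn : ℝ := ∑' x, h x ^ 2 with hnn
  have hnorm : (ρ:ℝ) ^ 2 * b ≤ nn := by
    have h2 : ∑ x ∈ ballF S ρ, h x ^ 2 ≤ nn :=
      (fs_summable (fs_sq hfs)).sum_le_tsum _ (fun _ _ => sq_nonneg _)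
    refine le_trans ?_ h2
    have h3 : ∑ x ∈ ballF S ρ, (ρ:ℝ) ^ 2 ≤ ∑ x ∈ ballF S ρ, h x ^ 2 :=
      Finset.sum_le_sum fun x hx => pow_le_pow_left₀ hρpos.le (tent_ge S h1 ρ x hx) 2
    refine le_trans (le_of_eq ?_) h3
    rw [Finset.sum_const, nsmul_eq_mul]; ring
  have hnnpos : 0 < nn := lt_of_lt_of_le (by positivity) hnorm
  have hE := tent_energy N S h1 ρ C0 hC0 hC0'
  have hsp : (1 - y) * nn ≤ ∑' x, h x * Pop (lmul N) h x := by
    rw [Pop_energy hr (lmul N) hfs]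
    have h2 : 1 / (4 * (r:ℝ)) * Energy (lmul N) h ≤ y * nn := by
      calc 1 / (4 * (r:ℝ)) * Energy (lmul N) h ≤ 1 / (4 * (r:ℝ)) * (r * (2 * C0 ^ 2 * B.card)) := by
            gcongr
        _ = C0 ^ 2 / 2 * B.card := by field_simp; norm_num
        _ ≤ C0 ^ 2 / 2 * (Q * b) := by gcongr
        _ = y * (ρ ^ 2 * b) := by rw [hy]; field_simp
        _ ≤ y * nn := by gcongr
    linarith
  obtain ⟨x, hx, hmax⟩ := surv_max (lmul N) B hfs (tent_nonneg S ρ) (tent_off S h1 ρ) (2 * ρ)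
    (tent_le S ρ) (by positivity) (1 - y) (by linarith) hnnpos hsp n
  have htr := surv_translate N S hinv ρ x hx (2 * n) 1
  rw [one_mul] at htr
  have hanti := surv_anti hr (lmul N) (ballF S (4 * ρ)) 1 (show n ≤ 2 * n by omega)
  refine le_trans ?_ hanti
  refine le_trans ?_ htr
  have hs0 := surv_nonneg (lmul N) B (2 * n) x
  have hexp : Real.exp (-(2 * C0 ^ 2 * Q * n / (ρ : ℝ) ^ 2)) ≤ (1 - y) ^ (2 * n) := by
    have h2 : Real.exp (-(2 * y)) ≤ 1 - y := by
      have h3 : 1 + 2 * y ≤ Real.exp (2 * y) := by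
        have := Real.add_one_le_exp (2 * y); linarith
      rw [Real.exp_neg]
      rw [inv_le_iff_one_le_mul₀ (Real.exp_pos _)]
      nlinarith
    calc Real.exp (-(2 * C0 ^ 2 * Q * n / (ρ : ℝ) ^ 2)) = Real.exp (-(2 * y)) ^ (2 * n) := by
          rw [← Real.exp_nat_mul]; congr 1; rw [hy]; push_cast; field_simp
      _ ≤ _ := pow_le_pow_left₀ (Real.exp_pos _).le h2 _
  have h5 : (1 - y) ^ (2 * n) * ((ρ:ℝ) ^ 2 * b) ≤ 4 * Q * surv (lmul N) B (2 * n) x * ((ρ:ℝ)^2 * b) := by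
    calc (1 - y) ^ (2 * n) * ((ρ:ℝ) ^ 2 * b) ≤ (1 - y) ^ (2 * n) * nn := by
          have : 0 ≤ 1 - y := by linarith
          gcongr
      _ ≤ (2 * ρ) ^ 2 * B.card * surv (lmul N) B (2 * n) x := hmax
      _ ≤ (2 * ρ) ^ 2 * (Q * b) * surv (lmul N) B (2 * n) x := by gcongr
      _ = _ := by ring
  have h6 := le_of_mul_le_mul_right h5 (by positivity)
  have h7 := hexp.trans h6
  rw [div_mul_eq_mul_div, one_mul, div_le_iff₀ (by positivity)]
  linarith

end survlow

section suppcount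
variable {Γ G : Type*} [Group Γ] [Group G] {r : ℕ}

lemma supp_count (π : Γ →* G) (hsurj : Function.Surjective π) (hcomm : IsMulCommutative π.ker)
    (s : Fin r → Γ) (B : Finset G) (hB1 : 1 ∈ B) :
    ∃ A : ℕ → Finset Γ, (∀ n, (A n).card ≤ B.card * (2 * n + 1) ^ (r * B.card)) ∧ 1 ∈ A 0 ∧
      ∀ n γ, π γ ∈ B → (γ ∈ A n → γ ∈ A (n + 1)) ∧
        ∀ j, (π (s j * γ) ∈ B → s j * γ ∈ A n → γ ∈ A (n + 1)) ∧
          (π ((s j)⁻¹ * γ) ∈ B → (s j)⁻¹ * γ ∈ A n → γ ∈ A (n + 1)) := by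
  classical
  let _ : CommGroup π.ker := { (inferInstance : Group π.ker) with mul_comm := hcomm.is_comm.comm }
  obtain ⟨t, ht, ht1⟩ : ∃ t : G → Γ, (∀ g, π (t g) = g) ∧ t 1 = 1 := by
    choose t0 ht0 using hsurj
    refine ⟨fun g => t0 g * (t0 1)⁻¹, fun g => ?_, mul_inv_cancel _⟩
    rw [map_mul, map_inv, ht0, ht0, inv_one, mul_one]
  let E : G → Fin r → π.ker := fun g i => ⟨(t (π (s i) * g))⁻¹ * s i * t g, by
    rw [MonoidHom.mem_ker, map_mul, map_mul, map_inv, ht, ht]; group⟩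
  have hE : ∀ g i, s i * t g = t (π (s i) * g) * (E g i : Γ) := by
    intro g i
    show _ = _ * ((t (π (s i) * g))⁻¹ * s i * t g)
    group
  let θ : (↥B × Fin r → ℤ) → π.ker := fun φ => ∏ e, (E e.1.1 e.2) ^ (φ e)
  have hθ : ∀ φ (e : ↥B × Fin r) (k : ℤ), θ (φ + Pi.single e k) = E e.1.1 e.2 ^ k * θ φ := by
    intro φ e k
    simp only [θ, Pi.add_apply, zpow_add, Finset.prod_mul_distrib]
    rw [mul_comm]
    congr 1
    rw [Finset.prod_eq_single e]
    · rw [Pi.single_eq_same]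
    · intro b _ hb
      rw [Pi.single_eq_of_ne hb, zpow_zero]
    · simp
  have hπ : ∀ (g : G) (φ), π (t g * (θ φ : Γ)) = g := by
    intro g φ
    rw [map_mul, ht, (MonoidHom.mem_ker).1 (θ φ).2, mul_one]
  let P : ℕ → Finset (↥B × (↥B × Fin r → ℤ)) := fun n =>
    Finset.univ ×ˢ Fintype.piFinset fun _ => Finset.Icc (-(n:ℤ)) n
  have hP : ∀ n p, p ∈ P n ↔ ∀ e, |p.2 e| ≤ n := by
    intro n p
    simp only [P, Finset.mem_product, Finset.mem_univ, true_and, Fintype.mem_piFinset,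
      Finset.mem_Icc, abs_le]
  let A : ℕ → Finset Γ := fun n => (P n).image fun p => t p.1.1 * (θ p.2 : Γ)
  have hA : ∀ n γ, γ ∈ A n ↔ ∃ p ∈ P n, t p.1.1 * (θ p.2 : Γ) = γ := by
    intro n γ
    simp only [A, Finset.mem_image]
  have hstep : ∀ (n : ℕ) (φ : ↥B × Fin r → ℤ) (e : ↥B × Fin r) (k : ℤ), |k| ≤ 1 → (∀ e, |φ e| ≤ n) →
      ∀ e', |(φ + (Pi.single e k : ↥B × Fin r → ℤ)) e'| ≤ ((n + 1 : ℕ) : ℤ) := by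
    intro n φ e k hk hφ e'
    rw [Pi.add_apply]
    have h1 : |(Pi.single e k : ↥B × Fin r → ℤ) e'| ≤ 1 := by
      by_cases h : e' = e
      · rw [h, Pi.single_eq_same]; exact hk
      · rw [Pi.single_eq_of_ne h]; norm_num
    have := abs_add_le (φ e') ((Pi.single e k : ↥B × Fin r → ℤ) e')
    have := hφ e'
    push_cast
    linarith
  refine ⟨A, ?_, ?_, ?_⟩
  · intro n
    refine Finset.card_image_le.trans ?_
    simp only [P, Finset.card_product, Finset.card_univ, Fintype.card_coe, Fintype.card_piFinset,
      Int.card_Icc, Finset.prod_const, Fintype.card_prod, Fintype.card_fin]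
    rw [show ((n:ℤ) + 1 - -(n:ℤ)).toNat = 2 * n + 1 by omega, mul_comm B.card r]
  · rw [hA]
    refine ⟨(⟨1, hB1⟩, 0), ?_, ?_⟩
    · rw [hP]; simp
    · simp [ht1, θ]
  · intro n γ hγ
    refine ⟨?_, fun j => ⟨?_, ?_⟩⟩
    · rw [hA, hA]
      rintro ⟨p, hp, h⟩
      refine ⟨p, ?_, h⟩
      rw [hP] at hp ⊢
      intro e
      have := hp e
      push_cast
      linarith
    · intro _ h
      rw [hA] at h
      obtain ⟨⟨g', φ⟩, hp, h⟩ := h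
      rw [hP] at hp
      have h2 := congrArg π h
      rw [hπ, map_mul] at h2
      rw [hA]
      refine ⟨(⟨π γ, hγ⟩, φ + Pi.single (⟨π γ, hγ⟩, j) (-1)), ?_, ?_⟩
      · rw [hP]
        exact hstep n φ _ (-1) (by norm_num) hp
      · simp only
        rw [hθ]
        simp only at h h2
        rw [h2] at h
        have h3 := hE (π γ) j
        rw [zpow_neg_one, Subgroup.coe_mul, Subgroup.coe_inv]
        have h4 : γ = (s j)⁻¹ * (t (π (s j) * π γ) * (θ φ : Γ)) := by rw [h]; group
        have h5 : t (π (s j) * π γ) = s j * t (π γ) * (E (π γ) j : Γ)⁻¹ := by rw [h3]; group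
        conv_rhs => rw [h4, h5]
        group
    · intro hmem h
      rw [hA] at h
      obtain ⟨⟨g', φ⟩, hp, h⟩ := h
      rw [hP] at hp
      have h2 := congrArg π h
      rw [hπ, map_mul, map_inv] at h2
      simp only at h h2
      have h2' : π (s j) * (g' : G) = π γ := by rw [h2]; group
      rw [hA]
      refine ⟨(⟨π γ, hγ⟩, φ + Pi.single (g', j) 1), ?_, ?_⟩
      · rw [hP]
        exact hstep n φ _ 1 (by norm_num) hp
      · simp only
        rw [hθ]
        have h3 := hE (g' : G) j
        rw [zpow_one, Subgroup.coe_mul, ← mul_assoc, ← h2', ← h3, mul_assoc, h]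
        group

end suppcount

section lower
variable {r : ℕ} (N : Subgroup (FreeGroup (Fin r))) [N.Normal]

/-- projection from the second to the first quotient -/
def prj : FreeGroup (Fin r) ⧸ ⁅N, N⁆ →* FreeGroup (Fin r) ⧸ N :=
  QuotientGroup.map ⁅N, N⁆ N (MonoidHom.id _) (by
    rw [Subgroup.comap_id]; exact Subgroup.commutator_le_left N N)

lemma prj_mk (x : FreeGroup (Fin r)) : prj N (x : FreeGroup (Fin r) ⧸ ⁅N, N⁆) =
    (x : FreeGroup (Fin r) ⧸ N) := rfl

lemma prj_surj : Function.Surjective (prj N) := by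
  intro g
  induction g using QuotientGroup.induction_on with
  | H z => exact ⟨(z : FreeGroup (Fin r) ⧸ ⁅N, N⁆), rfl⟩

lemma prj_comm : IsMulCommutative (prj N).ker := by
  refine ⟨⟨?_⟩⟩
  rintro ⟨a, ha⟩ ⟨b, hb⟩
  apply Subtype.ext
  show a * b = b * a
  induction a using QuotientGroup.induction_on with
  | H x =>
    induction b using QuotientGroup.induction_on with
    | H y =>
      have hx : x ∈ N := (QuotientGroup.eq_one_iff x).1 ha
      have hy : y ∈ N := (QuotientGroup.eq_one_iff y).1 hb
      rw [← QuotientGroup.mk_mul, ← QuotientGroup.mk_mul, QuotientGroup.eq]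
      have := Subgroup.commutator_mem_commutator (N.inv_mem hy) (N.inv_mem hx)
      rw [commutatorElement_def] at this
      convert this using 1
      group

lemma prj_lmul (j : Fin r) (γ : FreeGroup (Fin r) ⧸ ⁅N, N⁆) :
    prj N (lmul ⁅N, N⁆ j γ) = lmul N j (prj N γ) :=
  (prj N).map_mul ((FreeGroup.of j : FreeGroup (Fin r)) : FreeGroup (Fin r) ⧸ ⁅N, N⁆) γ

lemma prj_lmul_symm (j : Fin r) (γ : FreeGroup (Fin r) ⧸ ⁅N, N⁆) :
    prj N ((lmul ⁅N, N⁆ j).symm γ) = (lmul N j).symm (prj N γ) := by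
  rw [Equiv.eq_symm_apply, ← prj_lmul, Equiv.apply_symm_apply]

/-- killed walk on the second quotient -/
def kw (B : Finset (FreeGroup (Fin r) ⧸ N)) (n : ℕ) : FreeGroup (Fin r) ⧸ ⁅N, N⁆ → ℝ :=
  kit (lmul ⁅N, N⁆) (prj N ⁻¹' (B : Set (FreeGroup (Fin r) ⧸ N))) (walk (lmul ⁅N, N⁆) 1 0) n

variable (B : Finset (FreeGroup (Fin r) ⧸ N))

lemma kw_fs (n : ℕ) : HasFiniteSupport (kw N B n) := kit_fs _ _ (walk_fs _ _ 0) n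

lemma kw_nonneg (n : ℕ) : ∀ γ, 0 ≤ kw N B n γ := kit_nonneg _ _ (walk_nonneg _ _ 0) n

lemma kw_le (n : ℕ) : ∀ γ, kw N B n γ ≤ walk (lmul ⁅N, N⁆) 1 n γ := by
  induction n with
  | zero => exact fun _ => le_rfl
  | succ n ih =>
    intro γ
    exact (Kop_le_Pop _ _ (kw_nonneg N B n) γ).trans (Pop_mono _ ih γ)

lemma kw_zero_off (hB1 : 1 ∈ B) (γ : FreeGroup (Fin r) ⧸ ⁅N, N⁆)
    (hγ : γ ∉ prj N ⁻¹' (B : Set (FreeGroup (Fin r) ⧸ N))) : walk (lmul ⁅N, N⁆) 1 0 γ = 0 := by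
  simp only [walk]
  rw [if_neg]
  rintro rfl
  apply hγ
  rw [Set.mem_preimage, map_one]
  exact_mod_cast hB1

lemma kw_off (hB1 : 1 ∈ B) (n : ℕ) : ∀ γ, prj N γ ∉ B → kw N B n γ = 0 := fun γ hγ =>
  kit_off _ _ (kw_zero_off N B hB1) n γ (by rw [Set.mem_preimage]; exact_mod_cast hγ)

lemma kw_dual (hB1 : 1 ∈ B) (n m : ℕ) :
    ∑' γ, kw N B n γ * surv (lmul N) B m (prj N γ) = surv (lmul N) B (n + m) 1 := by
  classical
  induction n generalizing m with
  | zero =>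
    rw [tsum_eq_single 1]
    · simp [kw, kit, walk]
    · intro γ hγ
      simp [kw, kit, walk, hγ]
  | succ n ih =>
    rw [show n + 1 + m = n + (m + 1) by ring, ← ih (m + 1)]
    have h1 : ∀ γ, γ ∉ prj N ⁻¹' (B : Set (FreeGroup (Fin r) ⧸ N)) →
        (fun γ => surv (lmul N) B m (prj N γ)) γ = 0 := by
      intro γ hγ
      refine kit_off _ _ ?_ m (prj N γ) hγ
      intro x hx
      exact ind_not_mem (by exact_mod_cast hx)
    have h2 := Kop_adj (lmul ⁅N, N⁆) (prj N ⁻¹' (B : Set (FreeGroup (Fin r) ⧸ N)))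
      (kw_fs N B n) (kit_off _ _ (kw_zero_off N B hB1) n) h1
    refine Eq.trans h2 ?_
    congr 1
    funext γ
    congr 1
    by_cases hγ : prj N γ ∈ B
    · show _ = Kop _ _ _ _
      rw [Kop_of_mem _ _ (by rw [Set.mem_preimage]; exact_mod_cast hγ),
        Kop_of_mem _ _ (by exact_mod_cast hγ)]
      unfold Pop
      simp only [prj_lmul, prj_lmul_symm]
      rfl
    · show _ = Kop _ _ _ _
      rw [Kop_of_not_mem _ _ (by rw [Set.mem_preimage]; exact_mod_cast hγ),
        Kop_of_not_mem _ _ (by exact_mod_cast hγ)]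

lemma kw_mass (hB1 : 1 ∈ B) (n : ℕ) : ∑' γ, kw N B n γ = surv (lmul N) B n 1 := by
  have h := kw_dual N B hB1 n 0
  rw [add_zero] at h
  rw [← h]
  congr 1
  funext γ
  by_cases hγ : prj N γ ∈ B
  · show _ = _ * ind B _
    rw [ind_mem hγ, mul_one]
  · rw [kw_off N B hB1 n γ hγ, zero_mul]

lemma return_surv (hB1 : 1 ∈ B) (n : ℕ) :
    surv (lmul N) B n 1 ^ 2 ≤ ((B.card * (2 * n + 1) ^ (r * B.card) : ℕ) : ℝ) *
      walk (lmul ⁅N, N⁆) 1 (2 * n) 1 := by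
  obtain ⟨A, hcard, hA0, hA⟩ := supp_count (prj N) (prj_surj N) (prj_comm N)
    (fun j => ((FreeGroup.of j : FreeGroup (Fin r)) : FreeGroup (Fin r) ⧸ ⁅N, N⁆)) B hB1
  have hsupp : ∀ n γ, kw N B n γ ≠ 0 → γ ∈ A n := by
    intro n
    induction n with
    | zero =>
      intro γ h
      have : γ = 1 := by
        by_contra hne
        apply h
        simp [kw, kit, walk, hne]
      rw [this]; exact hA0
    | succ n ih =>
      intro γ h
      have hγ : prj N γ ∈ B := by
        by_contra hne
        exact h (kw_off N B hB1 _ γ hne)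
      by_contra hnot
      apply h
      show Kop _ _ (kw N B n) _ = 0
      rw [Kop_of_mem _ _ (by rw [Set.mem_preimage]; exact_mod_cast hγ)]
      have h0 : kw N B n γ = 0 := by
        by_contra hne
        exact hnot ((hA n γ hγ).1 (ih γ hne))
      have hj1 : ∀ j, kw N B n (lmul ⁅N, N⁆ j γ) = 0 := by
        intro j
        by_contra hne
        refine hnot (((hA n γ hγ).2 j).1 ?_ (ih _ hne))
        by_contra hne2
        exact hne (kw_off N B hB1 _ _ hne2)
      have hj2 : ∀ j, kw N B n ((lmul ⁅N, N⁆ j).symm γ) = 0 := by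
        intro j
        by_contra hne
        refine hnot (((hA n γ hγ).2 j).2 ?_ (ih _ hne))
        by_contra hne2
        exact hne (kw_off N B hB1 _ _ hne2)
      simp [Pop, h0, hj1, hj2]
  rw [← kw_mass N B hB1 n, show walk (lmul ⁅N, N⁆) 1 (2 * n) 1 = _ from
    (congrArg (fun k => walk (lmul ⁅N, N⁆) 1 k 1) (two_mul n)).trans (walk_two _ 1 n n)]
  have h1 : ∑' γ, kw N B n γ = ∑' γ, kw N B n γ * ind (A n) γ := by
    congr 1
    funext γ
    by_cases h : γ ∈ A n
    · rw [ind_mem h, mul_one]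
    · rw [ind_not_mem h, mul_zero]
      by_contra hne
      exact h (hsupp n γ hne)
  rw [h1]
  refine (cs_tsum (kw_fs N B n) (ind_fs (A n))).trans ?_
  have h2 : ∑' γ, ind (A n) γ ^ 2 = (A n).card := by
    have h3 := tsum_ite_finset (A n) 1
    rw [one_mul] at h3
    rw [← h3]
    congr 1
    funext γ
    unfold ind
    split_ifs <;> norm_num
  have h4 : ∑' γ, kw N B n γ ^ 2 ≤ ∑' γ, walk (lmul ⁅N, N⁆) 1 n γ * walk (lmul ⁅N, N⁆) 1 n γ := by
    refine (fs_summable (fs_sq (kw_fs N B n))).tsum_le_tsum (fun γ => ?_)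
      (fs_summable (fs_mul (walk_fs _ _ n) _))
    rw [sq]
    exact mul_le_mul (kw_le N B n γ) (kw_le N B n γ) (kw_nonneg N B n γ) (walk_nonneg _ _ n γ)
  rw [h2, mul_comm]
  have h5 : ((A n).card : ℝ) ≤ ((B.card * (2 * n + 1) ^ (r * B.card) : ℕ) : ℝ) := by
    exact_mod_cast hcard n
  exact mul_le_mul h5 h4 (tsum_nonneg fun _ => sq_nonneg _) (by positivity)

lemma lower_abs (hr : 0 < r) (D : ℕ) (hgrowth : HasPolyGrowth (FreeGroup (Fin r) ⧸ N) D) :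
    ∃ C1 : ℝ, 0 < C1 ∧ ∃ ρ0 : ℕ, 1 ≤ ρ0 ∧ ∀ n ρ : ℕ, 1 ≤ n → ρ0 ≤ ρ →
      Real.exp (-(C1 + C1 * (n / (ρ:ℝ) ^ 2) + C1 * ((ρ:ℝ) ^ D * Real.log (2 * n + 1)))) ≤
        convPow (lazySRWQuot r ⁅N, N⁆) (2 * n) 1 := by
  obtain ⟨S, hS1, hinv, hcl, c, C, hc, hcC, hg⟩ := growth_finset hgrowth
  obtain ⟨a, A, ha, hA, ρ0, hρ0, hs⟩ := surv_lower N hr D S hS1 hinv hcl c C hc hcC hg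
  have hC : 0 < C := hc.trans_le hcC
  set C1 : ℝ := |Real.log (a ^ 2)| + 2 * A + (r + 1) * (C * 4 ^ D) with hC1
  refine ⟨C1, by positivity, ρ0, hρ0, ?_⟩
  intro n ρ hn hρ
  rw [convPow_eq_walk]
  have hρpos : (0:ℝ) < ρ := by exact_mod_cast (by omega : 0 < ρ)
  set B := ballF S (4 * ρ) with hB
  have h1 := return_surv N B (ballF_one S hS1 _) n
  have h2 := hs ρ n hρ
  set p := walk (lmul ⁅N, N⁆) 1 (2 * n) 1 with hp
  set L := Real.log (2 * n + 1) with hL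
  have hn' : (1:ℝ) ≤ n := by exact_mod_cast hn
  have hL0 : 0 ≤ L := Real.log_nonneg (by linarith)
  have hBc : (B.card : ℝ) ≤ C * 4 ^ D * ρ ^ D := by
    have := (hg (4 * ρ) (by omega)).2
    push_cast at this
    rw [mul_pow] at this
    linarith
  have hden : ((B.card * (2 * n + 1) ^ (r * B.card) : ℕ) : ℝ) ≤
      Real.exp ((r + 1) * (C * 4 ^ D) * (ρ ^ D * L)) := by
    have h3 : B.card * (2 * n + 1) ^ (r * B.card) ≤ (2 * n + 1) ^ ((r + 1) * B.card) := by
      rw [show (r + 1) * B.card = B.card + r * B.card by ring, pow_add]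
      gcongr
      exact (Nat.lt_pow_self (by omega)).le
    have h4 : (((2 * n + 1) ^ ((r + 1) * B.card) : ℕ) : ℝ) = Real.exp ((r + 1) * B.card * L) := by
      have h5 : ((2 * n + 1 : ℕ) : ℝ) = Real.exp L := by
        rw [hL, Real.exp_log (by positivity)]; push_cast; ring
      rw [Nat.cast_pow, h5, ← Real.exp_nat_mul]
      push_cast
      ring_nf
    calc ((B.card * (2 * n + 1) ^ (r * B.card) : ℕ) : ℝ) ≤ (((2 * n + 1) ^ ((r + 1) * B.card) : ℕ) : ℝ) := by
          exact_mod_cast h3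
      _ = _ := h4
      _ ≤ _ := by
        apply Real.exp_le_exp.2
        calc ((r:ℝ) + 1) * B.card * L ≤ (r + 1) * (C * 4 ^ D * ρ ^ D) * L := by gcongr
          _ = _ := by ring
  have hp0 : 0 ≤ p := walk_nonneg _ _ _ _
  have h6 : (a * Real.exp (-(A * n / (ρ : ℝ) ^ 2))) ^ 2 ≤
      Real.exp ((r + 1) * (C * 4 ^ D) * (ρ ^ D * L)) * p :=
    (pow_le_pow_left₀ (by positivity) h2 2).trans (h1.trans (by gcongr))
  have h7 : (a * Real.exp (-(A * n / (ρ : ℝ) ^ 2))) ^ 2 =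
      Real.exp (Real.log (a ^ 2) - 2 * A * (n / ρ ^ 2)) := by
    rw [mul_pow, ← Real.exp_nat_mul, Real.exp_sub, Real.exp_log (by positivity), div_eq_mul_inv _ (Real.exp _),
      ← Real.exp_neg]
    congr 2
    push_cast
    ring
  rw [h7] at h6
  have h8 : Real.exp (Real.log (a ^ 2) - 2 * A * (n / ρ ^ 2) - (r + 1) * (C * 4 ^ D) * (ρ ^ D * L)) ≤ p := by
    rw [Real.exp_sub, div_le_iff₀ (Real.exp_pos _)]
    linarith
  refine le_trans (Real.exp_le_exp.2 ?_) h8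
  have hx : 0 ≤ (n:ℝ) / ρ ^ 2 := by positivity
  have hy : 0 ≤ (ρ:ℝ) ^ D * L := by positivity
  have e1 : |Real.log (a ^ 2)| ≤ C1 := by
    have : 0 ≤ 2 * A + (r + 1) * (C * 4 ^ D) := by positivity
    linarith
  have e2 : 2 * A ≤ C1 := by
    have : 0 ≤ |Real.log (a ^ 2)| + (r + 1) * (C * 4 ^ D) := by positivity
    linarith
  have e3 : (r + 1) * (C * 4 ^ D) ≤ C1 := by
    have : 0 ≤ |Real.log (a ^ 2)| + 2 * A := by positivity
    linarith
  have e4 := neg_abs_le (Real.log (a ^ 2))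
  have e5 := mul_le_mul_of_nonneg_right e2 hx
  have e6 := mul_le_mul_of_nonneg_right e3 hy
  linarith

end lower

lemma scale_exists (D n : ℕ) (hn : 2 ≤ n) (E : ℝ)
    (hE : E = (n : ℝ) ^ ((D : ℝ) / (2 + (D : ℝ))) * (Real.log n) ^ ((2 : ℝ) / (2 + (D : ℝ)))) :
    ∃ x : ℝ, 1 ≤ x ∧ x ^ 2 * E = n ∧ x ^ D * Real.log n = E ∧ 1 / 2 ≤ E ∧
      Real.log n ≤ 2 * (2 + D) * Real.log x := by
  have hn' : (2:ℝ) ≤ n := by exact_mod_cast hn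
  set L := Real.log n with hL
  have hl2 : 1 / 2 ≤ L := by
    have h1 := Real.log_two_gt_d9
    have h2 : Real.log 2 ≤ L := Real.log_le_log (by norm_num) hn'
    linarith
  have hL0 : 0 < L := by linarith
  have hLn : L ≤ n := (Real.log_le_sub_one_of_pos (by linarith)).trans (by linarith)
  have hn0 : (0:ℝ) < n := by linarith
  have hd : (0:ℝ) < 2 + D := by positivity
  set x : ℝ := ((n:ℝ) / L) ^ (1 / (2 + (D:ℝ))) with hx
  have hnL : 1 ≤ (n:ℝ) / L := by rw [le_div_iff₀ hL0]; linarith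
  have hx1 : 1 ≤ x := Real.one_le_rpow hnL (by positivity)
  have hx0 : 0 < x := by linarith
  have hxlog : Real.log x = (L - Real.log L) / (2 + D) := by
    rw [hx, Real.log_rpow (by positivity), Real.log_div hn0.ne' hL0.ne']
    ring
  have hEpos : 0 < E := by rw [hE]; positivity
  have hElog : Real.log E = D / (2 + D) * L + 2 / (2 + D) * Real.log L := by
    rw [hE, Real.log_mul (by positivity) (by positivity), Real.log_rpow hn0, Real.log_rpow hL0]
  have h1 : x ^ 2 * E = n := by
    apply Real.log_injOn_pos (Set.mem_Ioi.2 (by positivity)) (Set.mem_Ioi.2 hn0)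
    rw [Real.log_mul (by positivity) hEpos.ne', Real.log_pow, hxlog, hElog]
    push_cast
    rw [← hL]
    field_simp
    ring
  have h2 : x ^ D * L = E := by
    apply Real.log_injOn_pos (Set.mem_Ioi.2 (by positivity)) (Set.mem_Ioi.2 hEpos)
    rw [Real.log_mul (by positivity) hL0.ne', Real.log_pow, hxlog, hElog]
    field_simp
    ring
  refine ⟨x, hx1, h1, h2, ?_, ?_⟩
  · rw [← h2]
    have := one_le_pow₀ hx1 (n := D)
    nlinarith
  · have h3 : Real.log L ≤ L / 2 := by
      have h4 := Real.log_le_sub_one_of_pos (show 0 < L / 2 by positivity)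
      rw [Real.log_div hL0.ne' (by norm_num)] at h4
      have := Real.log_two_lt_d9
      linarith
    rw [hxlog]
    rw [show 2 * (2 + (D:ℝ)) * ((L - Real.log L) / (2 + D)) = 2 * (L - Real.log L) by field_simp]
    linarith

set_option maxHeartbeats 1000000 in
/-- Theorem: return probability of the metabelian-type cover. -/
theorem return_probability_nilpotent_cover (r : ℕ) (hr : 2 ≤ r)
    (N : Subgroup (FreeGroup (Fin r))) [N.Normal] (D : ℕ) (hD : 1 ≤ D)
    (hinf : Infinite (FreeGroup (Fin r) ⧸ N))
    (hnilp : Group.IsNilpotent (FreeGroup (Fin r) ⧸ N))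
    (hgrowth : HasPolyGrowth (FreeGroup (Fin r) ⧸ N) D) :
    ∃ C : ℝ, 1 ≤ C ∧ ∀ n : ℕ, 2 ≤ n →
      Real.exp (-C * (n : ℝ) ^ ((D : ℝ) / (2 + (D : ℝ))) *
          (Real.log n) ^ ((2 : ℝ) / (2 + (D : ℝ))))
        ≤ convPow (lazySRWQuot r ⁅N, N⁆) (2 * n) 1 ∧
      convPow (lazySRWQuot r ⁅N, N⁆) (2 * n) 1
        ≤ Real.exp (-(1 / C) * (n : ℝ) ^ ((D : ℝ) / (2 + (D : ℝ))) *
          (Real.log n) ^ ((2 : ℝ) / (2 + (D : ℝ)))) := by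
  obtain ⟨C1, hC1, ρ0, hρ0, hlow⟩ := lower_abs N (by omega) D hgrowth
  obtain ⟨κ0, δ, hκ0, hδ, hup⟩ := upper_abs r hr N D hnilp hgrowth
  have hd : (0:ℝ) < 2 + D := by positivity
  obtain ⟨R0, hR0⟩ := exists_nat_ge (32 * (2 + (D:ℝ)) / δ + 1)
  have hR0δ : 32 * (2 + (D:ℝ)) ≤ δ * R0 := by
    have : 32 * (2 + (D:ℝ)) / δ ≤ R0 := by linarith
    rw [div_le_iff₀ hδ] at this
    linarith
  have hR01 : (1:ℝ) ≤ R0 := by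
    have : 0 ≤ 32 * (2 + (D:ℝ)) / δ := by positivity
    linarith
  have hρ0' : (1:ℝ) ≤ ρ0 := by exact_mod_cast hρ0
  set C : ℝ := 1 + C1 * (3 + 3 * (2 * ρ0) ^ D) + 4 * R0 ^ 2 / κ0 with hC
  have hCa : 0 ≤ C1 * (3 + 3 * (2 * (ρ0:ℝ)) ^ D) := by positivity
  have hCb : 0 ≤ 4 * (R0:ℝ) ^ 2 / κ0 := by positivity
  have hC1' : 1 ≤ C := by linarith
  have hCpos : 0 < C := by linarith
  refine ⟨C, hC1', fun n hn => ?_⟩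
  rw [mul_assoc, mul_assoc]
  set E : ℝ := (n : ℝ) ^ ((D : ℝ) / (2 + (D : ℝ))) * (Real.log n) ^ ((2 : ℝ) / (2 + (D : ℝ))) with hE
  obtain ⟨x, hx1, hxE, hxD, hE2, hxlog⟩ := scale_exists D n hn E hE
  have hx0 : 0 < x := by linarith
  have hE0 : 0 < E := by linarith
  have hn' : (2:ℝ) ≤ n := by exact_mod_cast hn
  have hL0 : 0 ≤ Real.log n := Real.log_nonneg (by linarith)
  constructor
  · set ρ : ℕ := ⌈(ρ0:ℝ) * x⌉₊ with hρ
    have hρa : (ρ0:ℝ) * x ≤ ρ := Nat.le_ceil _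
    have hρb : (ρ:ℝ) ≤ 2 * ρ0 * x := by
      have := Nat.ceil_lt_add_one (show 0 ≤ (ρ0:ℝ) * x by positivity)
      rw [← hρ] at this
      have h1 : (1:ℝ) ≤ ρ0 * x := one_le_mul_of_one_le_of_one_le (by assumption) hx1
      linarith [mul_assoc 2 (ρ0:ℝ) x]
    have hρc : ρ0 ≤ ρ := by
      have : (ρ0:ℝ) ≤ ρ := (le_mul_of_one_le_right (by positivity) hx1).trans hρa
      exact_mod_cast this
    have hxρ : x ≤ ρ := (le_mul_of_one_le_left hx0.le (by assumption)).trans hρa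
    refine le_trans (Real.exp_le_exp.2 ?_) (hlow n ρ (by omega) hρc)
    have e1 : (n:ℝ) / ρ ^ 2 ≤ E := by
      rw [div_le_iff₀ (by positivity), ← hxE, mul_comm]
      gcongr
    have e2 : Real.log (2 * n + 1) ≤ 3 * Real.log n := by
      rw [show 3 * Real.log n = Real.log ((n:ℝ) ^ 3) by rw [Real.log_pow]; norm_num]
      apply Real.log_le_log (by linarith)
      nlinarith [mul_nonneg (show (0:ℝ) ≤ n by linarith) (show (0:ℝ) ≤ (n:ℝ) ^ 2 - 4 by nlinarith)]
    have e2' : 0 ≤ Real.log (2 * n + 1) := Real.log_nonneg (by linarith)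
    have e3 : (ρ:ℝ) ^ D * Real.log (2 * n + 1) ≤ 3 * (2 * ρ0) ^ D * E := by
      calc (ρ:ℝ) ^ D * Real.log (2 * n + 1) ≤ (2 * ρ0 * x) ^ D * (3 * Real.log n) := by gcongr
        _ = 3 * (2 * ρ0) ^ D * (x ^ D * Real.log n) := by rw [mul_pow _ x]; ring
        _ = _ := by rw [hxD]
    have e4 := mul_le_mul_of_nonneg_left e1 hC1.le
    have e5 := mul_le_mul_of_nonneg_left e3 hC1.le
    have e6 : C1 ≤ 2 * (C1 * E) := by nlinarith
    have e7 : C1 * (3 + 3 * (2 * ρ0) ^ D) * E ≤ C * E := by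
      apply mul_le_mul_of_nonneg_right _ hE0.le
      linarith
    have e8 : C1 * (3 + 3 * (2 * ρ0) ^ D) * E = 3 * (C1 * E) + C1 * (3 * (2 * ρ0) ^ D * E) := by ring
    linarith
  · set M : ℕ := ⌈(R0:ℝ) * x⌉₊ with hM
    have hMa : (R0:ℝ) * x ≤ M := Nat.le_ceil _
    have hMb : (M:ℝ) ≤ 2 * R0 * x := by
      have := Nat.ceil_lt_add_one (show 0 ≤ (R0:ℝ) * x by positivity)
      rw [← hM] at this
      have h1 : (1:ℝ) ≤ R0 * x := one_le_mul_of_one_le_of_one_le (by assumption) hx1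
      linarith [mul_assoc 2 (R0:ℝ) x]
    have hxM : x ≤ M := (le_mul_of_one_le_left hx0.le (by assumption)).trans hMa
    have hM1' : (1:ℝ) ≤ M := by linarith
    have hM1 : 1 ≤ M := by exact_mod_cast hM1'
    have hMpos : (0:ℝ) < M := by linarith
    set K : ℕ := ⌊δ * (M:ℝ) ^ D⌋₊ with hK
    have hKa : (K:ℝ) ≤ δ * (M:ℝ) ^ D := Nat.floor_le (by positivity)
    have hRD : (R0:ℝ) ≤ (R0:ℝ) ^ D := le_self_pow₀ hR01 (by omega)
    have hMD : (R0:ℝ) * x ^ D ≤ (M:ℝ) ^ D := by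
      calc (R0:ℝ) * x ^ D ≤ (R0:ℝ) ^ D * x ^ D := by gcongr
        _ = (R0 * x) ^ D := (mul_pow _ _ _).symm
        _ ≤ _ := by gcongr
    have hxD1 : 1 ≤ x ^ D := one_le_pow₀ hx1
    have hδM : 32 * (2 + (D:ℝ)) * x ^ D ≤ δ * (M:ℝ) ^ D := by
      calc 32 * (2 + (D:ℝ)) * x ^ D ≤ δ * R0 * x ^ D := by gcongr
        _ = δ * (R0 * x ^ D) := by ring
        _ ≤ _ := by gcongr
    have hKb : 16 * (2 + (D:ℝ)) * x ^ D ≤ K := by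
      have h1 := Nat.lt_floor_add_one (δ * (M:ℝ) ^ D)
      rw [← hK] at h1
      have h2 : 1 ≤ 16 * (2 + (D:ℝ)) * x ^ D := by nlinarith
      linarith
    have hlogM : Real.log x ≤ Real.log M := Real.log_le_log hx0 hxM
    have hlogx : 0 ≤ Real.log x := Real.log_nonneg hx1
    have hv : 8 * E ≤ K * Real.log M := by
      calc 8 * E = 8 * (x ^ D * Real.log n) := by rw [hxD]
        _ ≤ 8 * (x ^ D * (2 * (2 + D) * Real.log x)) := by gcongr
        _ = (16 * (2 + (D:ℝ)) * x ^ D) * Real.log x := by ring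
        _ ≤ K * Real.log M := by gcongr
    refine (hup n M K hM1 hKa).trans (max_le ?_ (Real.exp_le_exp.2 ?_))
    · have h4 : 4 / (M:ℝ) ^ K = Real.exp (Real.log 4 - K * Real.log M) := by
        rw [Real.exp_sub, Real.exp_log (by norm_num), Real.exp_nat_mul, Real.exp_log hMpos]
      rw [h4]
      apply Real.exp_le_exp.2
      have h5 : Real.log 4 ≤ 2 := by
        rw [show (4:ℝ) = 2 ^ 2 by norm_num, Real.log_pow]
        have := Real.log_two_lt_d9
        push_cast
        linarith
      have h6 : 1 / C ≤ 1 := by rw [div_le_one hCpos]; exact hC1'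
      have h6' := mul_le_mul_of_nonneg_right h6 hE0.le
      linarith
    · have h7 : E / (4 * R0 ^ 2) ≤ n / (M:ℝ) ^ 2 := by
        rw [div_le_div_iff₀ (by positivity) (by positivity), ← hxE]
        calc E * (M:ℝ) ^ 2 ≤ E * (2 * R0 * x) ^ 2 := by gcongr
          _ = _ := by ring
      have h8 : 1 / C ≤ κ0 / (4 * R0 ^ 2) := by
        rw [div_le_div_iff₀ hCpos (by positivity)]
        have : κ0 * (4 * (R0:ℝ) ^ 2 / κ0) = 4 * R0 ^ 2 := by field_simp
        have h9 : κ0 * (4 * (R0:ℝ) ^ 2 / κ0) ≤ κ0 * C := by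
          apply mul_le_mul_of_nonneg_left _ hκ0.le
          linarith
        linarith
      have h10 : 1 / C * E ≤ κ0 * n / (M:ℝ) ^ 2 := by
        calc 1 / C * E ≤ κ0 / (4 * R0 ^ 2) * E := by gcongr
          _ = κ0 * (E / (4 * R0 ^ 2)) := by ring
          _ ≤ κ0 * (n / (M:ℝ) ^ 2) := by gcongr
          _ = _ := by ring
      linarith

end
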